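/- Let (n, θ) be a closed cycle with the θ i not all equal, and fix m and odd k ≥ 1 as in the run condition. Let f′ be the cycle with n − k − 1 edges whose lengths are obtained from θ by replacing the k + 2 consecutive lengths θ (m−1), θ m, …, θ (m+k) by the single length θ (m−1) − θ m + θ (m+k), its creases being the creases of the original cycle other than m, m+1, …, m+k. Then f′ is again a closed cycle, and for every MV assignment μ : ZMod n → {mountain, valley} and each designation d ∈ {interior, exterior}: μ is flat foldable as a face with designation d if and only if exactly (k+1)/2 of the creases m, m+1, …, m+k are valleys under μ, and the restriction μ′ of μ to the creases of f′ is flat foldable as a face with designation d on f′. -/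

import Mathlib

/-- Mountain or valley fold type. -/
inductive MV
  | mountain
  | valley
deriving DecidableEq

/-- Designation of a face as interior or exterior. -/
inductive Des
  | interior
  | exterior
deriving DecidableEq

/-- The sign `ε` used at the top layer: `-1` for an interior face, `+1` for an
exterior face. -/
def epsOf : Des → ℝ
  | Des.interior => -1
  | Des.exterior => 1

/-- The folded coordinates of a closed cycle: `x 0 = 0` and
`x (i+1) = x i + (-1)^i * θ i`. -/
noncomputable def foldedX (n : ℕ) (θ : ZMod n → ℝ) : ZMod n → ℝ :=
  fun i => ∑ j ∈ Finset.range i.val, (-1 : ℝ) ^ j * θ (j : ZMod n)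

/-- `(n, θ)` is a closed cycle: `n` is even, `n ≥ 2`, all edge lengths are
positive, and the alternating sum of the edge lengths is zero. -/
noncomputable def IsClosedCycle (n : ℕ) (θ : ZMod n → ℝ) : Prop :=
  Even n ∧ 2 ≤ n ∧ (∀ i, 0 < θ i) ∧
    ∑ j ∈ Finset.range n, (-1 : ℝ) ^ j * θ (j : ZMod n) = 0

/-- The open interval whose endpoint set is `{a, b}`. -/
def betw (a b : ℝ) : Set ℝ := Set.Ioo (min a b) (max a b)

/-- `L` is a valid layering of the edges of a cycle folded to coordinates `x`:
`L` is injective; (i) no edge passes strictly between the two edges joined at a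
crease at the crease's coordinate; (ii) creases at the same coordinate opening in
the same direction are disjoint or nested. -/
def ValidLayering (n : ℕ) (x L : ZMod n → ℝ) : Prop :=
  Function.Injective L ∧
  (∀ i e : ZMod n, x i ∈ betw (x e) (x (e + 1)) →
      L e ∉ betw (L (i - 1)) (L i)) ∧
  (∀ i j : ZMod n, i ≠ j → x i = x j →
      Real.sign (x (i + 1) - x i) = Real.sign (x (j + 1) - x j) →
      Disjoint (betw (L (i - 1)) (L i)) (betw (L (j - 1)) (L j)) ∨
        betw (L (i - 1)) (L i) ⊆ betw (L (j - 1)) (L j) ∨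
        betw (L (j - 1)) (L j) ⊆ betw (L (i - 1)) (L i))

/-- The layering `L` realizes the MV assignment `μ` with top-layer sign `ε`:
taking `t` to be the index maximizing `L` and `s` the alternating `±1` map with
`s t = ε`, each crease `i` is a valley iff `s (i-1)` equals the sign of
`L i - L (i-1)`. -/
def Realizes (n : ℕ) (L : ZMod n → ℝ) (μ : ZMod n → MV) (ε : ℝ) : Prop :=
  ∃ t : ZMod n, (∀ j, L j ≤ L t) ∧
    ∃ s : ZMod n → ℝ, (∀ i, s i = 1 ∨ s i = -1) ∧ (∀ i, s (i + 1) = -s i) ∧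
      s t = ε ∧
      ∀ i, μ i = MV.valley ↔ s (i - 1) = Real.sign (L i - L (i - 1))

/-- The MV assignment `μ` on the closed cycle `(n, θ)` is flat foldable as a
face with designation `d`: some valid layering of the folded cycle realizes it. -/
noncomputable def FlatFoldable (n : ℕ) (θ : ZMod n → ℝ) (μ : ZMod n → MV)
    (d : Des) : Prop :=
  ∃ L : ZMod n → ℝ, ValidLayering n (foldedX n θ) L ∧ Realizes n L μ (epsOf d)

/-- The folded diameter of a closed cycle: `max x - min x` over the folded
coordinates. -/
noncomputable def foldedDiameter (n : ℕ) [NeZero n] (θ : ZMod n → ℝ) : ℝ :=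
  Finset.univ.sup' ⟨0, Finset.mem_univ 0⟩ (foldedX n θ) -
    Finset.univ.inf' ⟨0, Finset.mem_univ 0⟩ (foldedX n θ)

/-- The edge lengths of the reduced cycle `f'` in the odd case: the `k + 2`
consecutive lengths `θ (m-1), θ m, …, θ (m+k)` are replaced by the single length
`θ (m-1) - θ m + θ (m+k)` (indexed as the last edge), and edge `j` of `f'`
corresponds to original edge `m + k + 1 + j` otherwise, so that crease `j` of
`f'` is original crease `m + k + 1 + j`. -/
noncomputable def oddShrink (n : ℕ) (θ : ZMod n → ℝ) (m : ZMod n) (k : ℕ) :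
    ZMod (n - k - 1) → ℝ :=
  fun j =>
    if j.val = n - k - 2 then θ (m - 1) - θ m + θ (m + (k : ZMod n))
    else θ (m + (k : ZMod n) + 1 + (j.val : ZMod n))

/-- The restriction of an assignment on the original creases to the creases of
the reduced cycle `f'` in the odd case: crease `j` of `f'` is original crease
`m + k + 1 + j`, ranging over all original creases other than `m, …, m + k`. -/
def oddRestrict (n : ℕ) (μ : ZMod n → MV) (m : ZMod n) (k : ℕ) :
    ZMod (n - k - 1) → MV :=
  fun j => μ (m + (k : ZMod n) + 1 + (j.val : ZMod n))


namespace Crimp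
open Classical

variable {V : Type*} [Fintype V]

structure VL {V : Type*} (nx : Equiv.Perm V) (x L : V → ℝ) : Prop where
  inj : Function.Injective L
  h1 : ∀ i e, ((x e < x (nx i) ∧ x (nx i) < x (nx e)) ∨ (x (nx e) < x (nx i) ∧ x (nx i) < x e)) →
    (L e < L i ↔ L e < L (nx i))
  h2 : ∀ i j, i ≠ j → x (nx i) = x (nx j) → (x i < x (nx i) ↔ x j < x (nx j)) →
    ((L i < L j ↔ L i < L (nx j)) ↔ (L (nx i) < L j ↔ L (nx i) < L (nx j)))

def Zig {V : Type*} (nx : Equiv.Perm V) (x : V → ℝ) : Prop :=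
  ∀ i, (x i < x (nx i) ∧ x (nx (nx i)) < x (nx i)) ∨ (x (nx i) < x i ∧ x (nx i) < x (nx (nx i)))

def Conn {V : Type*} (nx : Equiv.Perm V) : Prop :=
  ∀ S : V → Prop, (∃ e, S e) → (∀ e, S e → S (nx e)) → ∀ e, S e

def RL {V : Type*} (nx : Equiv.Perm V) (L : V → ℝ) (μ : V → Prop) (ε : Prop) (s : V → Prop) : Prop :=
  (∀ i, s (nx i) ↔ ¬ s i) ∧ (∀ i, μ (nx i) ↔ (s i ↔ L i < L (nx i))) ∧
    ∃ t, (∀ j, L j ≤ L t) ∧ (s t ↔ ε)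

def FF {V : Type*} (nx : Equiv.Perm V) (x : V → ℝ) (μ : V → Prop) (ε : Prop) : Prop :=
  ∃ L, VL nx x L ∧ ∃ s, RL nx L μ ε s

noncomputable def bit (P : Prop) : ZMod 2 := if P then 1 else 0

lemma two0 (a : ZMod 2) : a + a = 0 := CharTwo.add_self_eq_zero a

lemma reindex (nx : Equiv.Perm V) (g h : V → ZMod 2) :
    ∑ f, g f * (h f + h (nx f)) = ∑ i, h (nx i) * (g i + g (nx i)) := by
  simp only [mul_add, Finset.sum_add_distrib]
  rw [← Equiv.sum_comp nx (fun f => g f * h f), add_comm]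
  congr 1 <;> exact Finset.sum_congr rfl fun i _ => mul_comm _ _

noncomputable def F (nx : Equiv.Perm V) (x L : V → ℝ) (e : V) (D : Set ℝ) : ZMod 2 :=
  ∑ f, bit (L e < L f) * (bit (x f ∈ D) + bit (x (nx f) ∈ D))

lemma lemA {nx : Equiv.Perm V} {x L : V → ℝ} (hv : VL nx x L) (e : V) (D1 D2 : Set ℝ)
    (l1 : IsLowerSet D1) (l2 : IsLowerSet D2) (s1 : x e ∈ D1 ↔ x (nx e) ∉ D1)
    (s2 : x e ∈ D2 ↔ x (nx e) ∉ D2) : F nx x L e D1 = F nx x L e D2 := by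
  rw [← CharTwo.add_eq_zero]
  have : F nx x L e D1 + F nx x L e D2 = ∑ f, bit (L e < L f) *
      ((bit (x f ∈ D1) + bit (x f ∈ D2)) + (bit (x (nx f) ∈ D1) + bit (x (nx f) ∈ D2))) := by
    simp only [F, ← Finset.sum_add_distrib]
    exact Finset.sum_congr rfl fun i _ => by ring
  rw [this, reindex nx (fun f => bit (L e < L f)) (fun f => bit (x f ∈ D1) + bit (x f ∈ D2))]
  apply Finset.sum_eq_zero
  intro i _
  by_cases hd : (x (nx i) ∈ D1 ↔ x (nx i) ∈ D2)
  · simp [hd, two0]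
  · have hlt : ∀ (D : Set ℝ), IsLowerSet D → ∀ p q, p ∈ D → q ∉ D → p < q := by
      intro D hD p q hp hq
      by_contra h
      exact hq (hD (not_lt.mp h) hp)
    have := hv.h1 i e (by
      by_cases a1 : x e ∈ D1 <;> by_cases a2 : x e ∈ D2 <;> by_cases b1 : x (nx i) ∈ D1 <;>
        by_cases b2 : x (nx i) ∈ D2 <;> simp only [a1, a2, b1, b2, iff_self, not_true_eq_false, true_iff, false_iff, not_not, iff_true, iff_false, not_false_eq_true] at s1 s2 hd
      all_goals
        first
        | (left; refine ⟨hlt D1 l1 _ _ ?_ ?_, hlt D2 l2 _ _ ?_ ?_⟩ <;> assumption)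
        | (left; refine ⟨hlt D2 l2 _ _ ?_ ?_, hlt D1 l1 _ _ ?_ ?_⟩ <;> assumption)
        | (right; refine ⟨hlt D1 l1 _ _ ?_ ?_, hlt D2 l2 _ _ ?_ ?_⟩ <;> assumption)
        | (right; refine ⟨hlt D2 l2 _ _ ?_ ?_, hlt D1 l1 _ _ ?_ ?_⟩ <;> assumption)
        | (exfalso; have p1 := hlt D1 l1 _ _ ‹x e ∈ D1› s1; have p2 := hlt D2 l2 _ _ s2 ‹x e ∉ D2›; linarith)
        | (exfalso; have p1 := hlt D2 l2 _ _ ‹x e ∈ D2› s2; have p2 := hlt D1 l1 _ _ s1 ‹x e ∉ D1›; linarith))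
    simp [this, two0]

lemma bit_not (P : Prop) : bit (¬ P) = bit P + 1 := by
  by_cases h : P <;> simp [bit, h]
  exact (two0 1).symm

lemma bitlem1 (p q y : ℝ) (h : p ≠ q) (hs : ¬ ((p < y ∧ y < q) ∨ (q < y ∧ y < p))) :
    bit (p ∈ Set.Iio y) + bit (q ∈ Set.Iio y) = bit (p = y ∧ q < y) + bit (q = y ∧ p < y) := by
  have : (1 + 1 : ZMod 2) = 0 := rfl
  simp only [Set.mem_Iio, bit]
  split_ifs <;> grind

lemma bitlem2 (p q y : ℝ) (h : p ≠ q) (hs : ¬ ((p < y ∧ y < q) ∨ (q < y ∧ y < p))) :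
    bit (p ∈ Set.Iic y) + bit (q ∈ Set.Iic y) = bit (p = y ∧ y < q) + bit (q = y ∧ y < p) := by
  have : (1 + 1 : ZMod 2) = 0 := rfl
  simp only [Set.mem_Iic, bit]
  split_ifs <;> grind

lemma lemB {nx : Equiv.Perm V} {x L : V → ℝ} (hv : VL nx x L) (hz : Zig nx x) (e : V) :
    ∃ D : Set ℝ, IsLowerSet D ∧ (x e ∈ D ↔ x (nx e) ∉ D) ∧ (x (nx e) ∈ D ↔ x (nx (nx e)) ∉ D) ∧
      F nx x L e D + F nx x L (nx e) D = 1 := by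
  have key : ∀ (D : Set ℝ) (T : ℝ → Prop),
      (∀ i, x (nx i) = x (nx e) → (T (x i) ↔ T (x (nx (nx i))))) →
      (∀ i, x (nx i) = x (nx e) → T (x i) → (x i < x (nx i) ↔ x e < x (nx e))) →
      T (x e) →
      (∀ f, ¬ ((x f < x (nx e) ∧ x (nx e) < x (nx f)) ∨ (x (nx f) < x (nx e) ∧ x (nx e) < x f)) →
        bit (x f ∈ D) + bit (x (nx f) ∈ D) =
          bit (x f = x (nx e) ∧ T (x (nx f))) + bit (x (nx f) = x (nx e) ∧ T (x f))) →
      F nx x L e D + F nx x L (nx e) D = 1 := by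
    intro D T hT1 hT2 hT3 hD
    set J : V → ZMod 2 := fun f => bit (L e < L f) + bit (L (nx e) < L f) with hJ
    have e1 : F nx x L e D + F nx x L (nx e) D = ∑ f, J f * (bit (x f ∈ D) + bit (x (nx f) ∈ D)) := by
      simp only [F, ← Finset.sum_add_distrib, hJ]
      exact Finset.sum_congr rfl fun i _ => by ring
    have e2 : ∀ f, J f * (bit (x f ∈ D) + bit (x (nx f) ∈ D)) =
        J f * bit (x f = x (nx e) ∧ T (x (nx f))) + J f * bit (x (nx f) = x (nx e) ∧ T (x f)) := by
      intro f
      by_cases hs : ((x f < x (nx e) ∧ x (nx e) < x (nx f)) ∨ (x (nx f) < x (nx e) ∧ x (nx e) < x f))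
      · have h := hv.h1 e f hs
        have n1 : f ≠ e := by rintro rfl; rcases hs with h | h <;> linarith [h.1, h.2]
        have n2 : f ≠ nx e := by rintro rfl; rcases hs with h | h <;> linarith [h.1, h.2]
        have m1 : L f ≠ L e := fun h => n1 (hv.inj h)
        have m2 : L f ≠ L (nx e) := fun h => n2 (hv.inj h)
        have : (L e < L f ↔ L (nx e) < L f) := by
          grind
        have : J f = 0 := by simp [hJ, this, two0]
        rw [this]; ring
      · rw [hD f hs]; ring
    rw [e1, Finset.sum_congr rfl fun f _ => e2 f, Finset.sum_add_distrib,
      ← Equiv.sum_comp nx (fun f => J f * bit (x f = x (nx e) ∧ T (x (nx f)))), ← Finset.sum_add_distrib,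
      Finset.sum_eq_single e]
    · have hne : L e ≠ L (nx e) := fun h => by
        have := hv.inj h
        have h2 := hz e
        rw [← this] at h2
        rcases h2 with h | h <;> linarith [h.1]
      have := (hT1 e rfl).1 hT3
      rcases lt_or_gt_of_ne hne with h | h <;> simp [hJ, bit, this, hT3, h, h.le]
    · intro i _ hi
      by_cases hx : x (nx i) = x (nx e)
      · rw [← hT1 i hx]
        by_cases ht : T (x i)
        · have := hv.h2 e i (Ne.symm hi) hx.symm (hT2 i hx ht).symm
          have : J i + J (nx i) = 0 := by
            simp only [hJ, bit]
            split_ifs <;> first | rfl | (exfalso; tauto)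
          simp only [hx, ht, bit, and_self, if_true, mul_one]
          rw [add_comm]; exact this
        · simp [ht, bit]
      · simp [hx, bit]
    · simp
  rcases hz e with ⟨h1, h2⟩ | ⟨h1, h2⟩
  · refine ⟨Set.Iio (x (nx e)), isLowerSet_Iio _, by simp [h1], by simp [h2], key _ (fun y => y < x (nx e)) ?_ ?_ h1 ?_⟩
    · intro i hi; have := hz i; grind
    · intro i hi ht; simp only [hi, ht, h1]
    · intro f hf
      have hn := hz f
      have hne : x f ≠ x (nx f) := by rcases hn with h | h <;> [exact h.1.ne; exact h.1.ne']
      exact bitlem1 _ _ _ hne hf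
  · refine ⟨Set.Iic (x (nx e)), isLowerSet_Iic _, by simp [h1], by simp [h2], key _ (fun y => x (nx e) < y) ?_ ?_ h1 ?_⟩
    · intro i hi; have := hz i; grind
    · intro i hi ht; rw [hi]; simp only [ht.not_gt, h1.not_gt]
    · intro f hf
      have hn := hz f
      have hne : x f ≠ x (nx f) := by rcases hn with h | h <;> [exact h.1.ne; exact h.1.ne']
      exact bitlem2 _ _ _ hne hf

lemma parity {nx : Equiv.Perm V} {x L : V → ℝ} (hv : VL nx x L) (hz : Zig nx x) (hc : Conn nx)
    (s : V → Prop) (hs : ∀ i, s (nx i) ↔ ¬ s i) (t : V) (ht : ∀ j, L j ≤ L t) :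
    ∀ e D, IsLowerSet D → (x e ∈ D ↔ x (nx e) ∉ D) → bit (s e) + F nx x L e D = bit (s t) := by
  apply hc (fun e => ∀ D, IsLowerSet D → (x e ∈ D ↔ x (nx e) ∉ D) → bit (s e) + F nx x L e D = bit (s t))
  · refine ⟨t, fun D _ _ => ?_⟩
    have : F nx x L t D = 0 := Finset.sum_eq_zero fun f _ => by
      simp [bit, (ht f).not_gt]
    rw [this, add_zero]
  · intro e he D hD hs2
    obtain ⟨D0, l0, p1, p2, p3⟩ := lemB hv hz e
    rw [← he D0 l0 p1, lemA hv (nx e) D D0 hD l0 hs2 p2, hs e, bit_not, ← p3]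
    generalize F nx x L (nx e) D0 = A
    generalize F nx x L e D0 = B
    have := two0 A
    linear_combination this

lemma exists_top [Nonempty V] (L : V → ℝ) : ∃ t, ∀ j, L j ≤ L t := Finite.exists_max L

end Crimp

namespace Crimp
open Classical

variable {V : Type*} [Fintype V]

lemma VL.negx {nx : Equiv.Perm V} {x L : V → ℝ} (hv : VL nx x L) (hz : Zig nx x) :
    VL nx (fun e => - x e) L := by
  refine ⟨hv.inj, fun i e h => hv.h1 i e ?_, fun i j hij h h' => hv.h2 i j hij ?_ ?_⟩
  · simp only [neg_lt_neg_iff] at h; tauto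
  · simpa using h
  · have a := hz i
    have b := hz j
    simp only [neg_lt_neg_iff] at h'
    grind

lemma Zig.negx {nx : Equiv.Perm V} {x : V → ℝ} (hz : Zig nx x) : Zig nx (fun e => - x e) := by
  intro i
  simp only [neg_lt_neg_iff]
  exact (hz i).symm

lemma FF.negx {nx : Equiv.Perm V} {x : V → ℝ} {μ : V → Prop} {ε : Prop} (hz : Zig nx x)
    (h : FF nx x μ ε) : FF nx (fun e => - x e) μ ε := by
  obtain ⟨L, hv, s, hs⟩ := h
  exact ⟨L, hv.negx hz, s, hs⟩

lemma VL.negL {nx : Equiv.Perm V} {x L : V → ℝ} (hv : VL nx x L) (hz : Zig nx x) :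
    VL nx x (fun e => - L e) := by
  have ne : ∀ e f, e ≠ f → L e ≠ L f := fun e f h h' => h (hv.inj h')
  refine ⟨fun e f h => hv.inj (neg_injective h), fun i e h => ?_, fun i j hij h h' => ?_⟩
  · have h1 := hv.h1 i e h
    have n1 : L e ≠ L i := ne _ _ (by rintro rfl; rcases h with h | h <;> linarith [h.1, h.2])
    have n2 : L e ≠ L (nx i) := ne _ _ (by rintro rfl; rcases h with h | h <;> linarith [h.1, h.2])
    simp only [neg_lt_neg_iff]; grind
  · have h2 := hv.h2 i j hij h h'
    have zi := hz i
    have zj := hz j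
    have n1 : L i ≠ L j := ne _ _ hij
    have n2 : L (nx i) ≠ L (nx j) := ne _ _ (fun h => hij (nx.injective h))
    have n3 : L i ≠ L (nx j) := ne _ _ (by rintro rfl; rcases zj with h | h <;> linarith [h.1, h.2])
    have n4 : L (nx i) ≠ L j := ne _ _ (by rintro rfl; rcases zi with h | h <;> linarith [h.1, h.2])
    simp only [neg_lt_neg_iff]
    clear zi zj hv hz ne h h'
    rcases lt_or_gt_of_ne n1 with a | a <;> rcases lt_or_gt_of_ne n2 with b | b <;>
    rcases lt_or_gt_of_ne n3 with c | c <;> rcases lt_or_gt_of_ne n4 with d | d <;>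
    simp_all [a.not_gt, b.not_gt, c.not_gt, d.not_gt]

lemma RL.negL {nx : Equiv.Perm V} {x L : V → ℝ} (hv : VL nx x L) (hz : Zig nx x) (hc : Conn nx)
    {μ : V → Prop} {ε : Prop} {s : V → Prop} (h : RL nx L μ ε s) :
    RL nx (fun e => - L e) μ ε (fun e => ¬ s e) := by
  obtain ⟨h1, h2, t, ht, hst⟩ := h
  refine ⟨fun i => by simp only [h1], fun i => ?_, ?_⟩
  · rw [h2]
    have : L i ≠ L (nx i) := fun h => by
      have := hv.inj h
      have h2 := hz i
      rw [← this] at h2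
      rcases h2 with h | h <;> linarith [h.1]
    simp only [neg_lt_neg_iff]; grind
  · have : Nonempty V := ⟨t⟩
    obtain ⟨b, hb⟩ := exists_top (fun e => - L e)
    refine ⟨b, hb, ?_⟩
    rw [← hst]
    obtain ⟨D, l, p, -, -⟩ := lemB hv hz b
    have := parity hv hz hc s h1 t ht b D l p
    have hF : F nx x L b D = 1 := by
      have tot : ∑ f, (1 : ZMod 2) * (bit (x f ∈ D) + bit (x (nx f) ∈ D)) = 0 := by
        rw [reindex nx (fun _ => (1 : ZMod 2)) (fun f => bit (x f ∈ D))]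
        exact Finset.sum_eq_zero fun i _ => by simp [two0]
      have : F nx x L b D + ∑ f, (1 : ZMod 2) * (bit (x f ∈ D) + bit (x (nx f) ∈ D)) = 1 := by
        rw [F, ← Finset.sum_add_distrib, Finset.sum_eq_single b]
        · by_cases hx : x b ∈ D
          · simp [bit, hx, p.1 hx]
          · have : x (nx b) ∈ D := by tauto
            simp [bit, hx, this]
        · intro f _ hf
          have : L b < L f := lt_of_le_of_ne (by have := hb f; linarith) (fun h => hf (hv.inj h.symm))
          simp only [this, bit, if_true]
          exact two0 _
        · simp
      rwa [tot, add_zero] at this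
    rw [hF, ← bit_not] at this
    simp only [bit] at this
    split_ifs at this <;> simp_all

lemma rank_exists {α : Type*} [LinearOrder α] (key : V → α) :
    ∃ L : V → ℝ, ∀ e f, L e < L f ↔ key e < key f := by
  have mono : ∀ e f, key e ≤ key f → (Finset.univ.filter (fun g => key g < key e)).card ≤
      (Finset.univ.filter (fun g => key g < key f)).card := by
    intro e f h
    apply Finset.card_le_card
    intro g
    simp only [Finset.mem_filter, Finset.mem_univ, true_and]
    exact fun h' => lt_of_lt_of_le h' h
  refine ⟨fun e => ((Finset.univ.filter (fun g => key g < key e)).card : ℝ), fun e f => ?_⟩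
  simp only [Nat.cast_lt]
  constructor
  · intro h
    by_contra h'
    exact absurd (mono f e (not_lt.mp h')) (not_le.mpr h)
  · intro h
    apply Finset.card_lt_card
    rw [Finset.ssubset_iff_of_subset]
    · exact ⟨e, by simp [h], by simp⟩
    · intro g
      simp only [Finset.mem_filter, Finset.mem_univ, true_and]
      exact fun h' => h'.trans h

lemma K3 {nx : Equiv.Perm V} {x L : V → ℝ} (hv : VL nx x L) (hz : Zig nx x) {u : V}
    (hab : x (nx u) < x (nx (nx u))) (hb : x (nx (nx u)) ≤ x u)
    (i : V) (hi : x (nx i) < x (nx (nx u))) :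
    (L u < L i ∧ L i < L (nx u) ∧ x (nx u) ≤ x i ∧ x (nx u) ≤ x (nx i)) ↔
    (L u < L (nx i) ∧ L (nx i) < L (nx u) ∧ x (nx u) ≤ x (nx i) ∧ x (nx u) ≤ x (nx (nx i))) := by
  have ne : ∀ e f, e ≠ f → L e ≠ L f := fun e f h h' => h (hv.inj h')
  have zi := hz i
  by_cases hiu : i = u
  · subst hiu; simp
  have n2 : L (nx i) ≠ L (nx u) := ne _ _ fun h => hiu (nx.injective h)
  have n3 : L i ≠ L u := ne _ _ hiu
  have n1 : L (nx i) ≠ L u := ne _ _ fun h => by rw [h] at hi; linarith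
  rcases lt_trichotomy (x (nx i)) (x (nx u)) with h | h | h
  · constructor <;> (rintro ⟨_, _, _, _⟩; linarith)
  · by_cases hd : x (nx i) < x i
    · have h2 := hv.h2 u i (Ne.symm hiu) h.symm (by constructor <;> intro <;> linarith)
      have n4 : L i ≠ L (nx u) := ne _ _ fun h' => by rw [h'] at hd; linarith
      have d2 : x (nx i) < x (nx (nx i)) := by rcases zi with h | h <;> linarith [h.1, h.2]
      grind
    · have d2 : x (nx (nx i)) < x (nx i) := by rcases zi with h | h <;> linarith [h.1, h.2]
      constructor <;> (rintro ⟨_, _, _, _⟩; exfalso; apply hd; rcases zi with h | h <;> linarith [h.1, h.2])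
  · have p1 := hv.h1 i u (Or.inr ⟨h, by linarith⟩)
    have p2 := hv.h1 i (nx u) (Or.inl ⟨h, hi⟩)
    have q1 := hv.h1 u i
    have q2 := hv.h1 u (nx i)
    have n4 : L i ≠ L (nx u) := ne _ _ fun h' => by rw [h'] at hi; exact lt_irrefl _ hi
    grind

lemma K4 {nx : Equiv.Perm V} {x L : V → ℝ} (hv : VL nx x L) (hz : Zig nx x) {u : V}
    (hab : x (nx u) < x (nx (nx u))) (ha : x (nx (nx (nx u))) ≤ x (nx u))
    (i : V) (hi : x (nx u) < x (nx i)) :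
    (L (nx u) < L i ∧ L i < L (nx (nx u)) ∧ x i ≤ x (nx (nx u)) ∧ x (nx i) ≤ x (nx (nx u))) ↔
    (L (nx u) < L (nx i) ∧ L (nx i) < L (nx (nx u)) ∧ x (nx i) ≤ x (nx (nx u)) ∧ x (nx (nx i)) ≤ x (nx (nx u))) := by
  have ne : ∀ e f, e ≠ f → L e ≠ L f := fun e f h h' => h (hv.inj h')
  have zi := hz i
  by_cases hiu : i = nx u
  · subst hiu; simp
  have n2 : L (nx i) ≠ L (nx (nx u)) := ne _ _ fun h => hiu (nx.injective h)
  have n3 : L i ≠ L (nx u) := ne _ _ hiu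
  have n1 : L (nx i) ≠ L (nx u) := ne _ _ fun h => by rw [h] at hi; linarith
  rcases lt_trichotomy (x (nx i)) (x (nx (nx u))) with h | h | h
  · have p1 := hv.h1 i (nx u) (Or.inl ⟨hi, h⟩)
    have p2 := hv.h1 i (nx (nx u)) (Or.inr ⟨by linarith, h⟩)
    have q1 := hv.h1 (nx u) i
    have q2 := hv.h1 (nx u) (nx i)
    have n4 : L i ≠ L (nx (nx u)) := ne _ _ fun h' => by rw [h'] at hi; linarith
    grind
  · by_cases hd : x i < x (nx i)
    · have h2 := hv.h2 (nx u) i (Ne.symm hiu) h.symm (by constructor <;> intro <;> linarith)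
      have n4 : L i ≠ L (nx (nx u)) := ne _ _ fun h' => by rw [h'] at hd; linarith
      have d2 : x (nx (nx i)) < x (nx i) := by rcases zi with h | h <;> linarith [h.1, h.2]
      grind
    · have d2 : x (nx i) < x (nx (nx i)) := by rcases zi with h | h <;> linarith [h.1, h.2]
      constructor <;> (rintro ⟨_, _, _, _⟩; exfalso; apply hd; rcases zi with h | h <;> linarith [h.1, h.2])
  · constructor <;> (rintro ⟨_, _, _, _⟩; linarith)

end Crimp

namespace Crimp
open Classical

variable {V V' : Type*} [Fintype V] [Fintype V']

structure CS {V V' : Type*} (nx : Equiv.Perm V) (nx' : Equiv.Perm V') (ι : V' → V) (u : V) (U : V') : Prop where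
  inj : Function.Injective ι
  hv : ∀ e, ι e ≠ nx u
  hw : ∀ e, ι e ≠ nx (nx u)
  surj : ∀ e, e ≠ nx u → e ≠ nx (nx u) → ∃ e', ι e' = e
  hU : ι U = u
  hn : ∀ e, e ≠ U → ι (nx' e) = nx (ι e)
  hnU : ι (nx' U) = nx (nx (nx u))

/-- the new order -/
lemma new_order {L : V → ℝ} (hi : Function.Injective L) (u : V) (Up : V → Prop) :
    ∃ M : V → ℝ, Function.Injective M ∧
      (∀ e f, e ≠ u → f ≠ u →
        (M e < M f ↔ ((¬ Up e ∧ Up f) ∨ ((Up e ↔ Up f) ∧ L e < L f)))) ∧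
      (∀ f, f ≠ u → (M u < M f ↔ Up f)) ∧
      (∀ f, f ≠ u → (M f < M u ↔ ¬ Up f)) := by
  let cl : V → ℕ := fun e => if e = u then 1 else if Up e then 2 else 0
  obtain ⟨M, hM⟩ := rank_exists (fun e => toLex (cl e, L e))
  have hM' : ∀ e f, M e < M f ↔ cl e < cl f ∨ (cl e = cl f ∧ L e < L f) := by
    intro e f
    rw [hM, Prod.Lex.toLex_lt_toLex]
  refine ⟨M, ?_, ?_, ?_, ?_⟩
  · intro e f hef
    by_contra hne
    have h1 := hM' e f
    have h2 := hM' f e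
    rw [hef] at h1 h2
    simp only [lt_irrefl, false_iff, not_or, not_and, not_lt] at h1 h2
    have h3 := le_antisymm h1.1 h2.1
    exact hne (hi (le_antisymm (h2.2 h3) (h1.2 h3.symm)))
  · intro e f h1 h2
    rw [hM']
    simp only [cl, h1, h2, if_false]
    by_cases a1 : Up e <;> by_cases a2 : Up f <;> simp [a1, a2]
  · intro f h2
    rw [hM']
    simp only [cl, h2, if_false, if_true]
    by_cases a1 : Up f <;> simp [a1]
  · intro f h2
    rw [hM']
    simp only [cl, h2, if_false, if_true]
    by_cases a1 : Up f <;> simp [a1]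

set_option maxHeartbeats 2000000 in
lemma forward_VL {nx : Equiv.Perm V} {nx' : Equiv.Perm V'} {ι : V' → V} {u : V} {U : V'}
    (cs : CS nx nx' ι u U) {x L M : V → ℝ} (hv : VL nx x L) (hz : Zig nx x)
    (hab : x (nx u) < x (nx (nx u))) (hb : x (nx (nx u)) ≤ x u)
    (ha : x (nx (nx (nx u))) ≤ x (nx u))
    (hL1 : L u < L (nx u)) (hL2 : L (nx u) < L (nx (nx u)))
    (PR QL Up : V → Prop)
    (hPR : ∀ e, PR e ↔ (L u < L e ∧ L e < L (nx u) ∧ x (nx u) ≤ x e ∧ x (nx u) ≤ x (nx e)))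
    (hQL : ∀ e, QL e ↔ (L (nx u) < L e ∧ L e < L (nx (nx u)) ∧ x e ≤ x (nx (nx u)) ∧ x (nx e) ≤ x (nx (nx u))))
    (hUp : ∀ e, Up e ↔ PR e ∨ (L (nx u) < L e ∧ ¬ QL e))
    (k3 : ∀ i, x (nx i) < x (nx (nx u)) → (PR i ↔ PR (nx i)))
    (k4 : ∀ i, x (nx u) < x (nx i) → (QL i ↔ QL (nx i)))
    (hi : Function.Injective M)
    (o1 : ∀ e f, e ≠ u → f ≠ u → (M e < M f ↔ ((¬ Up e ∧ Up f) ∨ ((Up e ↔ Up f) ∧ L e < L f))))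
    (o2 : ∀ f, f ≠ u → (M u < M f ↔ Up f))
    (o3 : ∀ f, f ≠ u → (M f < M u ↔ ¬ Up f)) :
    VL nx' (fun e => x (ι e)) (fun e => M (ι e)) := by
  have ne : ∀ e f, e ≠ f → L e ≠ L f := fun e f h h' => h (hv.inj h')
  have U1 : ∀ e, e ≠ nx u → e ≠ nx (nx u) → (x e < x (nx (nx u)) ∨ x (nx e) < x (nx (nx u))) →
      (Up e ↔ PR e ∨ L (nx (nx u)) < L e) := by
    intro e e2 e3 he
    have q := hv.h1 (nx u) e
    have := ne _ _ e2; have := ne _ _ e3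
    have := hUp e; have := hQL e; have := hPR e
    grind
  have U2 : ∀ e, e ≠ u → e ≠ nx u → (x (nx u) < x e ∨ x (nx u) < x (nx e)) →
      (Up e ↔ L u < L e ∧ ¬ QL e) := by
    intro e e2 e3 he
    have q := hv.h1 u e
    have := ne _ _ e2; have := ne _ _ e3
    have := hUp e; have := hQL e; have := hPR e
    grind
  have zu : nx (nx (nx u)) ≠ u := fun h => by rw [h] at ha; linarith
  have zv : nx (nx (nx u)) ≠ nx u := fun h => by
    have h := nx.injective h
    rw [h] at hL2; linarith
  have zw : nx (nx (nx u)) ≠ nx (nx u) := fun h => by rw [h] at ha; linarith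
  have Uz : Up (nx (nx (nx u))) ↔ L (nx (nx u)) < L (nx (nx (nx u))) := by
    rw [U1 _ zv zw (Or.inl (by linarith)), ← k3 (nx (nx u)) (by linarith), hPR]
    have : ¬ (L (nx (nx u)) < L (nx u)) := by linarith
    tauto
  have Uc : ∀ i, nx i = u → i ≠ u → i ≠ nx u → (Up i ↔ L u < L i) := by
    intro i hi i1 i2
    rw [U2 _ i1 i2 (Or.inr (by rw [hi]; linarith)), k4 i (by rw [hi]; linarith), hi, hQL]
    have : ¬ (L (nx u) < L u) := by linarith
    tauto
  have G1 : ∀ i e, i ≠ u → i ≠ nx u → i ≠ nx (nx u) → nx i ≠ u → nx i ≠ nx u → nx i ≠ nx (nx u) →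
      e ≠ u → e ≠ nx u → e ≠ nx (nx u) →
      ((x e < x (nx i) ∧ x (nx i) < x (nx e)) ∨ (x (nx e) < x (nx i) ∧ x (nx i) < x e)) →
      (M e < M i ↔ M e < M (nx i)) := by
    intro i e i1 i2 i3 j1 j2 j3 e1 e2 e3 hs
    have h := hv.h1 i e hs
    rw [o1 e _ e1 i1, o1 e _ e1 j1]
    rcases lt_or_ge (x (nx i)) (x (nx (nx u))) with hy | hy
    · have r3 := k3 i hy
      have a1 := U1 i i2 i3 (Or.inr hy)
      have a2 := U1 (nx i) j2 j3 (Or.inl hy)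
      have a3 := U1 e e2 e3 (by rcases hs with h | h; left; linarith [h.1]; right; linarith [h.1])
      have h3 := hv.h1 i (nx (nx u))
      have p1 := hPR e
      have p2 := hPR i
      have p3 := hPR (nx i)
      have n1 := ne _ _ i3
      have n2 := ne _ _ j3
      clear hPR hQL hUp k3 k4 o1 o2 o3 U1 U2 Uz Uc ne
      by_cases hp : PR i
      · simp only [hp, r3.1 hp] at *
        grind
      · have hp' : ¬ PR (nx i) := fun h => hp (r3.2 h)
        by_cases he : PR e <;> simp only [hp, hp', he, false_or, true_or, false_iff, true_iff] at * <;> grind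
    · have hy' : x (nx u) < x (nx i) := by linarith
      have r4 := k4 i hy'
      have a1 := U2 i i1 i2 (Or.inr hy')
      have a2 := U2 (nx i) j1 j2 (Or.inl hy')
      have a3 := U2 e e1 e2 (by rcases hs with h | h; right; linarith [h.2]; left; linarith [h.2])
      have p1 := hQL e
      have p2 := hQL i
      have p3 := hQL (nx i)
      clear hPR hQL hUp k3 k4 o1 o2 o3 U1 U2 Uz Uc ne
      by_cases hp : QL i
      · simp only [hp, r4.1 hp] at *
        grind
      · have hp' : ¬ QL (nx i) := fun h => hp (r4.2 h)
        by_cases he : QL e <;> simp only [hp, hp', he, false_or, true_or, false_iff, true_iff] at * <;> grind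
  have G2 : ∀ i j, i ≠ u → i ≠ nx u → i ≠ nx (nx u) → nx i ≠ u → nx i ≠ nx u → nx i ≠ nx (nx u) →
      j ≠ u → j ≠ nx u → j ≠ nx (nx u) → nx j ≠ u → nx j ≠ nx u → nx j ≠ nx (nx u) →
      i ≠ j → x (nx i) = x (nx j) → (x i < x (nx i) ↔ x j < x (nx j)) →
      ((M i < M j ↔ M i < M (nx j)) ↔ (M (nx i) < M j ↔ M (nx i) < M (nx j))) := by
    intro i j i1 i2 i3 j1 j2 j3 i1' i2' i3' j1' j2' j3' hij hy hor
    have h := hv.h2 i j hij hy hor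
    rw [o1 _ _ i1 i1', o1 _ _ j1 i1', o1 _ _ i1 j1', o1 _ _ j1 j1']
    rcases lt_or_ge (x (nx i)) (x (nx (nx u))) with hy1 | hy1
    · have hy2 := hy ▸ hy1
      have r3 := k3 i hy1
      have r3' := k3 j hy2
      have a1 := U1 i i2 i3 (Or.inr hy1)
      have a2 := U1 (nx i) j2 j3 (Or.inl hy1)
      have a1' := U1 j i2' i3' (Or.inr hy2)
      have a2' := U1 (nx j) j2' j3' (Or.inl hy2)
      have p0 := hPR i
      have p1 := hPR j
      have p2 := hPR (nx i)
      have p3 := hPR (nx j)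
      clear hPR hQL hUp k3 k4 o1 o2 o3 U1 U2 Uz Uc ne G1
      by_cases hp : PR i <;> by_cases hq : PR j
      all_goals simp only [r3, r3'] at hp hq
      all_goals simp only [r3, r3', hp, hq, false_or, true_or, iff_true] at a1 a2 a1' a2' p0 p1 p2 p3
      all_goals simp only [a1, a2, a1', a2']
      all_goals grind
    · have hy1 : x (nx u) < x (nx i) := by linarith
      have hy2 := hy ▸ hy1
      have r3 := k4 i hy1
      have r3' := k4 j hy2
      have a1 := U2 i i1 i2 (Or.inr hy1)
      have a2 := U2 (nx i) j1 j2 (Or.inl hy1)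
      have a1' := U2 j i1' i2' (Or.inr hy2)
      have a2' := U2 (nx j) j1' j2' (Or.inl hy2)
      have p0 := hQL i
      have p1 := hQL j
      have p2 := hQL (nx i)
      have p3 := hQL (nx j)
      clear hPR hQL hUp k3 k4 o1 o2 o3 U1 U2 Uz Uc ne G1
      by_cases hp : QL i <;> by_cases hq : QL j
      all_goals simp only [r3, r3'] at hp hq
      all_goals simp only [r3, r3', hp, hq, false_or, true_or, iff_true, not_true_eq_false, and_false, not_false_eq_true, and_true, iff_false] at a1 a2 a1' a2' p0 p1 p2 p3
      all_goals simp only [a1, a2, a1', a2']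
      all_goals grind
  have GB : ∀ j, j ≠ u → j ≠ nx u → j ≠ nx (nx u) → nx j ≠ u → nx j ≠ nx u → nx j ≠ nx (nx u) →
      x (nx (nx (nx u))) = x (nx j) → (x u < x (nx (nx (nx u))) ↔ x j < x (nx j)) →
      ((M u < M j ↔ M u < M (nx j)) ↔ (M (nx (nx (nx u))) < M j ↔ M (nx (nx (nx u))) < M (nx j))) := by
    intro j i1 i2 i3 j1 j2 j3 hy hor
    have h := hv.h2 (nx (nx u)) j i3.symm hy (by
      have : ¬ (x u < x (nx (nx (nx u)))) := by linarith
      have : ¬ (x (nx (nx u)) < x (nx (nx (nx u)))) := by linarith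
      tauto)
    rw [o2 _ i1, o2 _ j1, o1 _ _ zu i1, o1 _ _ zu j1]
    have hy1 : x (nx j) < x (nx (nx u)) := by linarith
    have r3 := k3 j hy1
    have a1 := U1 j i2 i3 (Or.inr hy1)
    have a2 := U1 (nx j) j2 j3 (Or.inl hy1)
    have p0 := hPR j
    have p2 := hPR (nx j)
    clear hPR hQL hUp k3 k4 o1 o2 o3 U1 U2 Uc ne G1 G2
    by_cases hp : PR j
    all_goals simp only [r3] at hp
    all_goals simp only [r3, hp, false_or, true_or, iff_true] at a1 a2 p0 p2
    all_goals simp only [a1, a2]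
    all_goals grind
  have GC : ∀ i j, nx i = u → i ≠ u → i ≠ nx u → i ≠ nx (nx u) →
      j ≠ u → j ≠ nx u → j ≠ nx (nx u) → nx j ≠ u → nx j ≠ nx u → nx j ≠ nx (nx u) →
      i ≠ j → x u = x (nx j) → (x i < x u ↔ x j < x (nx j)) →
      ((M i < M j ↔ M i < M (nx j)) ↔ (M u < M j ↔ M u < M (nx j))) := by
    intro i j hi i1' i2' i3' i1 i2 i3 j1 j2 j3 hij hy hor
    have h := hv.h2 i j hij (by rw [hi]; exact hy) (by rw [hi]; exact hor)
    have b1 := Uc i hi i1' i2'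
    rw [hi] at h
    rw [o2 _ i1, o2 _ j1, o1 _ _ i1' i1, o1 _ _ i1' j1]
    have hy1 : x (nx u) < x (nx j) := by linarith
    have r3 := k4 j hy1
    have a1 := U2 j i1 i2 (Or.inr hy1)
    have a2 := U2 (nx j) j1 j2 (Or.inl hy1)
    have p0 := hQL j
    have p2 := hQL (nx j)
    clear hPR hQL hUp k3 k4 o1 o2 o3 U1 U2 Uc ne G1 G2 GB
    by_cases hp : QL j
    all_goals simp only [r3] at hp
    all_goals simp only [r3, hp, false_or, true_or, iff_true, not_true_eq_false, and_false, not_false_eq_true, and_true, iff_false] at a1 a2 p0 p2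
    all_goals simp only [a1, a2]
    all_goals grind
  have nU : ∀ e, e ≠ U → ι e ≠ u := fun e he h => he (cs.inj (h.trans cs.hU.symm))
  have nuw : u ≠ nx (nx u) := fun h => by rw [← h] at hL2; linarith
  have symm2 : ∀ i' j', i' ≠ j' → x (ι (nx' i')) = x (ι (nx' j')) → x (ι i') ≠ x (ι (nx' i')) →
      x (ι j') ≠ x (ι (nx' j')) →
      ((M (ι j') < M (ι i') ↔ M (ι j') < M (ι (nx' i'))) ↔ (M (ι (nx' j')) < M (ι i') ↔ M (ι (nx' j')) < M (ι (nx' i')))) →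
      ((M (ι i') < M (ι j') ↔ M (ι i') < M (ι (nx' j'))) ↔ (M (ι (nx' i')) < M (ι j') ↔ M (ι (nx' i')) < M (ι (nx' j')))) := by
    intro i' j' hij hy h1 h2 h
    have n1 : M (ι i') ≠ M (ι j') := fun h => hij (cs.inj (hi h))
    have n2 : M (ι (nx' i')) ≠ M (ι (nx' j')) := fun h => hij (nx'.injective (cs.inj (hi h)))
    have n3 : M (ι i') ≠ M (ι (nx' j')) := fun h => h1 (by rw [hi h, hy])
    have n4 : M (ι (nx' i')) ≠ M (ι j') := fun h => h2 (by rw [← hi h, hy])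
    have fl : ∀ p q : ℝ, p ≠ q → (q < p ↔ ¬ p < q) := fun p q hpq =>
      ⟨fun h => not_lt.2 h.le, fun h => lt_of_le_of_ne (not_lt.1 h) hpq.symm⟩
    rw [fl _ _ n1, fl _ _ n2, fl _ _ n3, fl _ _ n4] at h
    tauto
  refine ⟨fun e f h => cs.inj (hi h), ?_, ?_⟩
  · intro i' e' hs
    by_cases hi' : i' = U
    · subst hi'
      simp only [cs.hnU, cs.hU] at hs ⊢
      by_cases he' : e' = i'
      · subst he'
        rw [cs.hnU, cs.hU] at hs; exfalso; rcases hs with h | h <;> linarith [h.1, h.2]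
      · have e1 := nU _ he'
        have e2 := cs.hv e'
        have e3 := cs.hw e'
        rw [cs.hn e' he'] at hs
        generalize ι e' = e at *
        rw [o3 e e1, o1 e _ e1 zu]
        have h := hv.h1 (nx (nx u)) e hs
        have q := U1 e e2 e3 (by rcases hs with h | h; left; linarith [h.1]; right; linarith [h.1])
        have p := hPR e
        have := ne _ _ e3
        clear hPR hQL hUp k3 k4 o1 o2 o3 U1 U2 Uc ne G1 G2 GB GC
        grind
    · have i1 := nU _ hi'
      have i2 := cs.hv i'
      have i3 := cs.hw i'
      have j2 := cs.hv (nx' i')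
      have j3 := cs.hw (nx' i')
      simp only [cs.hn i' hi'] at hs j2 j3 ⊢
      generalize ι i' = i at *
      by_cases hC : nx i = u
      · by_cases he' : e' = U
        · subst he'
          rw [cs.hnU, cs.hU, hC] at hs; exfalso; rcases hs with h | h <;> linarith [h.1, h.2]
        · have e1 := nU _ he'
          have e2 := cs.hv e'
          have e3 := cs.hw e'
          rw [cs.hn e' he'] at hs
          generalize ι e' = e at *
          have h := hv.h1 i e hs
          have b1 := Uc i hC i1 i2
          rw [hC] at h hs ⊢
          rw [o3 e e1, o1 e _ e1 i1]
          have q := U2 e e1 e2 (by rcases hs with h | h; right; linarith [h.2]; left; linarith [h.2])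
          have p := hQL e
          have := ne _ _ e1
          clear hPR hQL hUp k3 k4 o1 o2 o3 U1 U2 Uc ne G1 G2 GB GC
          grind
      · by_cases he' : e' = U
        · subst he'
          rw [cs.hnU, cs.hU] at hs
          rw [cs.hU, o2 _ i1, o2 _ hC]
          have := ne _ _ i1; have := ne _ _ i2; have := ne _ _ i3
          have := ne _ _ j2; have := ne _ _ j3; have := ne _ _ hC
          rcases lt_or_ge (x (nx i)) (x (nx (nx u))) with hy | hy
          · have r3 := k3 i hy
            have h3 := hv.h1 i (nx (nx u)) (by right; constructor <;> rcases hs with h | h <;> linarith [h.1, h.2])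
            rw [U1 i i2 i3 (Or.inr hy), U1 _ j2 j3 (Or.inl hy), r3, h3]
          · have hy' : x (nx u) < x (nx i) := by linarith
            have r4 := k4 i hy'
            have h3 := hv.h1 i u (by right; constructor <;> rcases hs with h | h <;> linarith [h.1, h.2])
            rw [U2 i i1 i2 (Or.inr hy'), U2 _ hC j2 (Or.inl hy'), r4, h3]
        · have e1 := nU _ he'
          rw [cs.hn e' he'] at hs
          exact G1 i _ i1 i2 i3 hC j2 j3 e1 (cs.hv e') (cs.hw e') hs
  · have key : ∀ i' j', i' ≠ j' → x (ι (nx' i')) = x (ι (nx' j')) → (x (ι i') < x (ι (nx' i')) ↔ x (ι j') < x (ι (nx' j'))) →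
        (i' = U ∨ (nx (ι i') = u ∧ j' ≠ U) ∨ (nx (ι i') ≠ u ∧ nx (ι j') ≠ u ∧ i' ≠ U ∧ j' ≠ U)) →
        ((M (ι i') < M (ι j') ↔ M (ι i') < M (ι (nx' j'))) ↔ (M (ι (nx' i')) < M (ι j') ↔ M (ι (nx' i')) < M (ι (nx' j')))) := by
      intro i' j' hij hy hor hc
      rcases hc with hc | ⟨hc, hj'⟩ | ⟨hc1, hc2, hi', hj'⟩
      · subst hc
        have hj' := hij.symm
        have j2 := cs.hv (nx' j')
        have j3 := cs.hw (nx' j')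
        simp only [cs.hnU, cs.hU, cs.hn _ hj'] at hy hor j2 j3 ⊢
        have hc : nx (ι j') ≠ u := fun h => by rw [h] at hy; linarith
        exact GB _ (nU _ hj') (cs.hv _) (cs.hw _) hc j2 j3 hy hor
      · have hi' : i' ≠ U := fun h => by
          subst h
          rw [cs.hU] at hc; rw [hc] at hL1; linarith
        have j2 := cs.hv (nx' j')
        have j3 := cs.hw (nx' j')
        simp only [cs.hn _ hi', cs.hn _ hj', hc] at hy hor j2 j3 ⊢
        have hij' : ι i' ≠ ι j' := fun h => hij (cs.inj h)
        have hc' : nx (ι j') ≠ u := fun h => hij' (nx.injective (hc.trans h.symm))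
        exact GC _ _ hc (nU _ hi') (cs.hv _) (cs.hw _) (nU _ hj') (cs.hv _) (cs.hw _) hc' j2 j3 hij' hy hor
      · have j2 := cs.hv (nx' j')
        have j3 := cs.hw (nx' j')
        have i2 := cs.hv (nx' i')
        have i3 := cs.hw (nx' i')
        simp only [cs.hn _ hi', cs.hn _ hj'] at hy hor i2 i3 j2 j3 ⊢
        have hij' : ι i' ≠ ι j' := fun h => hij (cs.inj h)
        exact G2 _ _ (nU _ hi') (cs.hv _) (cs.hw _) hc1 i2 i3 (nU _ hj') (cs.hv _) (cs.hw _) hc2 j2 j3 hij' hy hor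
    have xne : ∀ i', x (ι i') ≠ x (ι (nx' i')) := by
      intro i'
      by_cases h : i' = U
      · subst h; rw [cs.hU, cs.hnU]; intro h; linarith
      · rw [cs.hn _ h]; have := hz (ι i'); grind
    intro i' j' hij hy hor
    by_cases hc : (i' = U ∨ (nx (ι i') = u ∧ j' ≠ U) ∨ (nx (ι i') ≠ u ∧ nx (ι j') ≠ u ∧ i' ≠ U ∧ j' ≠ U))
    · exact key i' j' hij hy hor hc
    · apply symm2 i' j' hij hy (xne _) (xne _)
      exact key j' i' hij.symm hy.symm hor.symm (by tauto)

end Crimp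

namespace Crimp
open Classical

variable {V V' : Type*} [Fintype V] [Fintype V']

lemma forward_adj {nx : Equiv.Perm V} {nx' : Equiv.Perm V'} {ι : V' → V} {u : V} {U : V'}
    (cs : CS nx nx' ι u U) {x L M : V → ℝ} (hv : VL nx x L) (hz : Zig nx x)
    (hab : x (nx u) < x (nx (nx u))) (hb : x (nx (nx u)) ≤ x u)
    (ha : x (nx (nx (nx u))) ≤ x (nx u))
    (hL1 : L u < L (nx u)) (hL2 : L (nx u) < L (nx (nx u)))
    (PR QL Up : V → Prop)
    (hPR : ∀ e, PR e ↔ (L u < L e ∧ L e < L (nx u) ∧ x (nx u) ≤ x e ∧ x (nx u) ≤ x (nx e)))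
    (hQL : ∀ e, QL e ↔ (L (nx u) < L e ∧ L e < L (nx (nx u)) ∧ x e ≤ x (nx (nx u)) ∧ x (nx e) ≤ x (nx (nx u))))
    (hUp : ∀ e, Up e ↔ PR e ∨ (L (nx u) < L e ∧ ¬ QL e))
    (k3 : ∀ i, x (nx i) < x (nx (nx u)) → (PR i ↔ PR (nx i)))
    (k4 : ∀ i, x (nx u) < x (nx i) → (QL i ↔ QL (nx i)))
    (hi : Function.Injective M)
    (o1 : ∀ e f, e ≠ u → f ≠ u → (M e < M f ↔ ((¬ Up e ∧ Up f) ∨ ((Up e ↔ Up f) ∧ L e < L f))))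
    (o2 : ∀ f, f ≠ u → (M u < M f ↔ Up f))
    (o3 : ∀ f, f ≠ u → (M f < M u ↔ ¬ Up f)) :
    (∀ i', i' ≠ U → (M (ι i') < M (ι (nx' i')) ↔ L (nx.symm (ι (nx' i'))) < L (ι (nx' i')))) ∧
    (M u < M (nx (nx (nx u))) ↔ L (nx (nx u)) < L (nx (nx (nx u)))) := by
  have ne : ∀ e f, e ≠ f → L e ≠ L f := fun e f h h' => h (hv.inj h')
  have U1 : ∀ e, e ≠ nx u → e ≠ nx (nx u) → (x e < x (nx (nx u)) ∨ x (nx e) < x (nx (nx u))) →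
      (Up e ↔ PR e ∨ L (nx (nx u)) < L e) := by
    intro e e2 e3 he
    have q := hv.h1 (nx u) e
    have := ne _ _ e2; have := ne _ _ e3
    have := hUp e; have := hQL e; have := hPR e
    grind
  have U2 : ∀ e, e ≠ u → e ≠ nx u → (x (nx u) < x e ∨ x (nx u) < x (nx e)) →
      (Up e ↔ L u < L e ∧ ¬ QL e) := by
    intro e e2 e3 he
    have q := hv.h1 u e
    have := ne _ _ e2; have := ne _ _ e3
    have := hUp e; have := hQL e; have := hPR e
    grind
  have zu : nx (nx (nx u)) ≠ u := fun h => by rw [h] at ha; linarith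
  have zv : nx (nx (nx u)) ≠ nx u := fun h => by
    have h := nx.injective h
    rw [h] at hL2; linarith
  have zw : nx (nx (nx u)) ≠ nx (nx u) := fun h => by rw [h] at ha; linarith
  have Uz : Up (nx (nx (nx u))) ↔ L (nx (nx u)) < L (nx (nx (nx u))) := by
    rw [U1 _ zv zw (Or.inl (by linarith)), ← k3 (nx (nx u)) (by linarith), hPR]
    have : ¬ (L (nx (nx u)) < L (nx u)) := by linarith
    tauto
  have Uc : ∀ i, nx i = u → i ≠ u → i ≠ nx u → (Up i ↔ L u < L i) := by
    intro i hi i1 i2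
    rw [U2 _ i1 i2 (Or.inr (by rw [hi]; linarith)), k4 i (by rw [hi]; linarith), hi, hQL]
    have : ¬ (L (nx u) < L u) := by linarith
    tauto
  have nU : ∀ e, e ≠ U → ι e ≠ u := fun e he h => he (cs.inj (h.trans cs.hU.symm))
  refine ⟨?_, by rw [o2 _ zu, Uz]⟩
  intro i' hi'
  have i1 := nU _ hi'
  have i2 := cs.hv i'
  have i3 := cs.hw i'
  have j2 := cs.hv (nx' i')
  have j3 := cs.hw (nx' i')
  simp only [cs.hn i' hi', Equiv.symm_apply_apply] at j2 j3 ⊢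
  generalize ι i' = i at *
  by_cases hC : nx i = u
  · rw [hC, o3 _ i1, Uc i hC i1 i2]
    have := ne _ _ i1
    grind
  · rw [o1 _ _ i1 hC]
    rcases lt_or_ge (x (nx i)) (x (nx (nx u))) with hy | hy
    · have r3 := k3 i hy
      rw [U1 i i2 i3 (Or.inr hy), U1 _ j2 j3 (Or.inl hy), r3]
      clear hPR hQL hUp k3 k4 o1 o2 o3 U1 U2 Uz Uc ne
      grind
    · have hy' : x (nx u) < x (nx i) := by linarith
      have r4 := k4 i hy'
      rw [U2 i i1 i2 (Or.inr hy'), U2 _ hC j2 (Or.inl hy'), r4]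
      clear hPR hQL hUp k3 k4 o1 o2 o3 U1 U2 Uz Uc ne
      grind

lemma bit3 (P Q T : Prop) (h1 : P → ¬ T) (h2 : Q → T) :
    bit (P ∨ (T ∧ ¬ Q)) = bit T + bit P + bit Q := by
  have t0 := two0 1
  by_cases q3 : T
  · by_cases q2 : Q <;> by_cases q1 : P <;> simp [bit, q1, q2, q3, t0] <;> tauto
  · by_cases q2 : Q <;> by_cases q1 : P <;> simp [bit, q1, q2, q3, t0] <;> tauto

set_option maxHeartbeats 1000000 in
lemma crimp_up {nx : Equiv.Perm V} {nx' : Equiv.Perm V'} {ι : V' → V} {u : V} {U : V'}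
    (cs : CS nx nx' ι u U) {x L : V → ℝ} (hv : VL nx x L) (hz : Zig nx x) (hc : Conn nx)
    (hz' : Zig nx' (fun e => x (ι e))) (hc' : Conn nx')
    (hab : x (nx u) < x (nx (nx u))) (hb : x (nx (nx u)) ≤ x u)
    (ha : x (nx (nx (nx u))) ≤ x (nx u))
    (hL1 : L u < L (nx u)) (hL2 : L (nx u) < L (nx (nx u))) {μ s : V → Prop} {ε : Prop}
    (hs : RL nx L μ ε s) : FF nx' (fun e => x (ι e)) (fun e => μ (ι e)) ε := by
  obtain ⟨PR, hPR⟩ : ∃ PR : V → Prop, ∀ e, PR e ↔ (L u < L e ∧ L e < L (nx u) ∧ x (nx u) ≤ x e ∧ x (nx u) ≤ x (nx e)) := ⟨_, fun e => Iff.rfl⟩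
  obtain ⟨QL, hQL⟩ : ∃ QL : V → Prop, ∀ e, QL e ↔ (L (nx u) < L e ∧ L e < L (nx (nx u)) ∧ x e ≤ x (nx (nx u)) ∧ x (nx e) ≤ x (nx (nx u))) := ⟨_, fun e => Iff.rfl⟩
  obtain ⟨Up, hUp⟩ : ∃ Up : V → Prop, ∀ e, Up e ↔ PR e ∨ (L (nx u) < L e ∧ ¬ QL e) := ⟨_, fun e => Iff.rfl⟩
  have k3 : ∀ i, x (nx i) < x (nx (nx u)) → (PR i ↔ PR (nx i)) := fun i h => by
    rw [hPR, hPR]; exact K3 hv hz hab hb i h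
  have k4 : ∀ i, x (nx u) < x (nx i) → (QL i ↔ QL (nx i)) := fun i h => by
    rw [hQL, hQL]; exact K4 hv hz hab ha i h
  obtain ⟨M, hi, o1, o2, o3⟩ := new_order hv.inj u Up
  have hVL := forward_VL cs hv hz hab hb ha hL1 hL2 PR QL Up hPR hQL hUp k3 k4 hi o1 o2 o3
  obtain ⟨ad1, ad2⟩ := forward_adj cs hv hz hab hb ha hL1 hL2 PR QL Up hPR hQL hUp k3 k4 hi o1 o2 o3
  obtain ⟨h1, h2, t, ht, hst⟩ := hs
  have alt' : ∀ i, s (ι (nx' i)) ↔ ¬ s (ι i) := by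
    intro i
    by_cases h : i = U
    · subst h; rw [cs.hnU, cs.hU, h1, h1, h1]; tauto
    · rw [cs.hn _ h, h1]
  haveI : Nonempty V' := ⟨U⟩
  obtain ⟨t', ht'⟩ := exists_top (fun e => M (ι e))
  refine ⟨_, hVL, fun e => s (ι e), alt', ?_, t', ht', ?_⟩
  · intro i
    by_cases h : i = U
    · subst h
      simp only [cs.hnU, cs.hU]
      rw [ad2, h2, h1, h1]; tauto
    · have := ad1 i h
      simp only
      rw [this, cs.hn _ h, h2, Equiv.symm_apply_apply]
  · rw [← hst]
    have nU : ∀ e, e ≠ U → ι e ≠ u := fun e he h => he (cs.inj (h.trans cs.hU.symm))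
    have p1 := parity hv hz hc s h1 t ht (nx u) (Set.Iic (x (nx u))) (isLowerSet_Iic _) (by simp [hab])
    have p2 := parity hVL hz' hc' (fun e => s (ι e)) alt' t' ht' U (Set.Iic (x (nx u))) (isLowerSet_Iic _) (by
      simp only [cs.hU, cs.hnU, Set.mem_Iic, ha, not_true_eq_false, iff_false, not_le]; linarith)
    have key : F nx' (fun e => x (ι e)) (fun e => M (ι e)) U (Set.Iic (x (nx u))) =
        F nx x L (nx u) (Set.Iic (x (nx u))) + 1 := by
      set D := Set.Iic (x (nx u)) with hD
      set d : V → ZMod 2 := fun f => bit (x f ∈ D) + bit (x (nx f) ∈ D) with hd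
      have c1 : F nx' (fun e => x (ι e)) (fun e => M (ι e)) U D = ∑ f' ∈ Finset.univ.erase U, bit (Up (ι f')) * d (ι f') := by
        unfold F
        rw [← Finset.add_sum_erase _ _ (Finset.mem_univ U)]
        simp only [lt_irrefl]
        rw [show bit False = 0 by simp [bit], zero_mul, zero_add]
        refine Finset.sum_congr rfl fun f' hf => ?_
        have hf : f' ≠ U := (Finset.mem_erase.1 hf).1
        rw [cs.hU, cs.hn _ hf, o2 _ (nU _ hf)]
      have c2 : ∑ f' ∈ Finset.univ.erase U, bit (Up (ι f')) * d (ι f') =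
          ∑ f ∈ ((Finset.univ.erase (nx (nx u))).erase (nx u)).erase u, bit (Up f) * d f := by
        refine Finset.sum_bij (fun f _ => ι f) ?_ ?_ ?_ ?_
        · intro f hf
          simp only [Finset.mem_erase, Finset.mem_univ, and_true] at hf ⊢
          exact ⟨nU _ hf, cs.hv _, cs.hw _⟩
        · intro a _ b _ h; exact cs.inj h
        · intro f hf
          simp only [Finset.mem_erase, Finset.mem_univ, and_true] at hf
          obtain ⟨f', rfl⟩ := cs.surj f hf.2.1 hf.2.2
          exact ⟨f', by simp; rintro rfl; exact hf.1 cs.hU, rfl⟩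
        · intros; rfl
      have nuv : u ≠ nx u := fun h => by rw [← h] at hL1; linarith
      have nvw : nx u ≠ nx (nx u) := fun h => by rw [← h] at hL2; linarith
      have nuw : u ≠ nx (nx u) := fun h => by rw [← h] at hL2; linarith
      have b0 : bit False = 0 := by simp [bit]
      have b1 : bit True = 1 := by simp [bit]
      have uu : Up u ↔ False := by rw [hUp, hPR]; simp; intro h; linarith
      have uv : Up (nx u) ↔ False := by rw [hUp, hPR]; simp
      have uw : Up (nx (nx u)) ↔ True := by rw [hUp, hPR, hQL]; simp [hL2]
      have dw : d (nx (nx u)) = 1 := by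
        simp only [hd, hD, Set.mem_Iic, ha, not_le.2 hab, b0, b1, zero_add]
      have c3 : ∑ f, bit (Up f) * d f = 1 + ∑ f ∈ ((Finset.univ.erase (nx (nx u))).erase (nx u)).erase u, bit (Up f) * d f := by
        rw [← Finset.add_sum_erase _ _ (Finset.mem_univ (nx (nx u))),
          ← Finset.add_sum_erase (Finset.univ.erase (nx (nx u))) _ (a := nx u) (by simp [nvw]),
          ← Finset.add_sum_erase ((Finset.univ.erase (nx (nx u))).erase (nx u)) _ (a := u) (by simp [nuv, nuw]),
          uu, uv, uw, b0, b1, dw]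
        ring
      have sP : ∑ f, bit (PR f) * d f = 0 := by
        rw [hd, reindex nx (fun f => bit (PR f)) (fun f => bit (x f ∈ D))]
        refine Finset.sum_eq_zero fun i _ => ?_
        by_cases hx : x (nx i) ∈ D
        · rw [k3 i (lt_of_le_of_lt hx hab), two0, mul_zero]
        · simp [hx, b0]
      have sQ : ∑ f, bit (QL f) * d f = 0 := by
        have hd' : ∀ f, d f = (bit (x f ∈ D) + 1) + (bit (x (nx f) ∈ D) + 1) := by
          intro f
          have := two0 1
          linear_combination -this
        simp only [hd']
        rw [reindex nx (fun f => bit (QL f)) (fun f => bit (x f ∈ D) + 1)]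
        refine Finset.sum_eq_zero fun i _ => ?_
        by_cases hx : x (nx i) ∈ D
        · simp [hx, b1, two0]
        · rw [k4 i (by simpa [hD] using hx), two0, mul_zero]
      have c4 : ∑ f, bit (Up f) * d f = F nx x L (nx u) D + ∑ f, bit (PR f) * d f + ∑ f, bit (QL f) * d f := by
        unfold F
        rw [← Finset.sum_add_distrib, ← Finset.sum_add_distrib]
        refine Finset.sum_congr rfl fun f _ => ?_
        have : bit (Up f) = bit (L (nx u) < L f) + bit (PR f) + bit (QL f) := by
          have a1 := hUp f
          have a2 := hPR f
          have a3 := hQL f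
          have a4 : PR f → ¬ L (nx u) < L f := fun h => by have := (a2.1 h).2.1; linarith
          have a5 : QL f → L (nx u) < L f := fun h => (a3.1 h).1
          rw [a1]
          exact bit3 _ _ _ a4 a5
        rw [this]; ring
      rw [c1, c2]
      rw [sP, sQ, c3] at c4
      have := two0 1
      linear_combination c4 - this
    rw [key, cs.hU] at p2
    have hsv := bit_not (s u)
    rw [← (congrArg bit (propext (h1 u)))] at hsv
    have : bit (s (ι t')) = bit (s t) := by
      rw [← p1, ← p2, hsv]; ring
    by_cases q1 : s (ι t') <;> by_cases q2 : s t <;> simp_all [bit]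

lemma crimp_forward {nx : Equiv.Perm V} {nx' : Equiv.Perm V'} {ι : V' → V} {u : V} {U : V'}
    (cs : CS nx nx' ι u U) {x : V → ℝ} (hz : Zig nx x) (hc : Conn nx)
    (hz' : Zig nx' (fun e => x (ι e))) (hc' : Conn nx')
    (hab : x (nx u) < x (nx (nx u))) (hb : x (nx (nx u)) ≤ x u)
    (ha : x (nx (nx (nx u))) ≤ x (nx u)) {μ : V → Prop} {ε : Prop}
    (hμ : μ (nx u) ↔ ¬ μ (nx (nx u)))
    (hf : FF nx x μ ε) : FF nx' (fun e => x (ι e)) (fun e => μ (ι e)) ε := by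
  obtain ⟨L, hv, s, hs⟩ := hf
  have e : (L u < L (nx u) ↔ L (nx u) < L (nx (nx u))) := by
    have a1 := hs.1 u
    have a2 := hs.2.1 u
    have a3 := hs.2.1 (nx u)
    tauto
  by_cases h : L u < L (nx u)
  · exact crimp_up cs hv hz hc hz' hc' hab hb ha h (e.1 h) hs
  · have n1 : L u ≠ L (nx u) := fun h => by rw [← hv.inj h] at hb hab; linarith [hz u]
    have n2 : L (nx u) ≠ L (nx (nx u)) := fun h => by rw [← hv.inj h] at hab; linarith
    have h1 := lt_of_le_of_ne (not_lt.1 h) n1.symm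
    have h2 := lt_of_le_of_ne (not_lt.1 (fun h' => h (e.2 h'))) n2.symm
    exact crimp_up cs (hv.negL hz) hz hc hz' hc' hab hb ha (neg_lt_neg h1) (neg_lt_neg h2) (hs.negL hv hz hc)

end Crimp

namespace Crimp
open Classical

variable {V V' : Type*} [Fintype V] [Fintype V']

set_option maxHeartbeats 1000000 in
lemma crimp_rev_up {nx : Equiv.Perm V} {nx' : Equiv.Perm V'} {ι : V' → V} {u : V} {U : V'}
    (cs : CS nx nx' ι u U) {x : V → ℝ} {L' : V' → ℝ} (hz : Zig nx x)
    (hz' : Zig nx' (fun e => x (ι e))) (hv' : VL nx' (fun e => x (ι e)) L')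
    (hab : x (nx u) < x (nx (nx u))) (hb : x (nx (nx u)) ≤ x u)
    (ha : x (nx (nx (nx u))) ≤ x (nx u)) (huw : u ≠ nx (nx u)) {μ : V → Prop} {ε : Prop} {s' : V' → Prop}
    (hμ : μ (nx u) ↔ ¬ μ (nx (nx u))) (hs : RL nx' L' (fun e => μ (ι e)) ε s')
    (hup : μ (nx u) ↔ s' U) : FF nx x μ ε := by
  obtain ⟨π, hπ, πv, πw⟩ : ∃ π : V → V', (∀ e, π (ι e) = e) ∧ π (nx u) = U ∧ π (nx (nx u)) = U := by
    refine ⟨fun e => if h : ∃ e', ι e' = e then h.choose else U, fun e => ?_, ?_, ?_⟩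
    · have h : ∃ e', ι e' = ι e := ⟨e, rfl⟩
      simp only [h, dif_pos]
      exact cs.inj h.choose_spec
    · simp only; rw [dif_neg]; rintro ⟨e, he⟩; exact cs.hv e he
    · simp only; rw [dif_neg]; rintro ⟨e, he⟩; exact cs.hw e he
  have πu : π u = U := by rw [← cs.hU, hπ]
  have nuv : u ≠ nx u := fun h => by rw [← h] at hab hb; rw [← h] at hab; linarith
  have nvw : nx u ≠ nx (nx u) := fun h => nuv (nx.injective h)
  have ιπ : ∀ e, e ≠ nx u → e ≠ nx (nx u) → ι (π e) = e := by
    intro e h1 h2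
    obtain ⟨e', rfl⟩ := cs.surj e h1 h2
    rw [hπ]
  have πU : ∀ e, π e = U → e = u ∨ e = nx u ∨ e = nx (nx u) := by
    intro e h
    by_cases h1 : e = nx u
    · tauto
    by_cases h2 : e = nx (nx u)
    · tauto
    left; rw [← ιπ e h1 h2, h, cs.hU]
  have πn : ∀ i, i ≠ u → i ≠ nx u → π (nx i) = nx' (π i) := by
    intro i h1 h2
    by_cases h3 : i = nx (nx u)
    · rw [h3, πw, ← cs.hnU, hπ]
    · have := ιπ i h2 h3
      rw [← this, hπ, ← cs.hn, hπ]
      intro h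
      rw [h, cs.hU] at this; exact h1 this.symm
  have xn : ∀ i, i ≠ u → i ≠ nx u → x (ι (nx' (π i))) = x (nx i) := by
    intro i h1 h2
    rw [← πn i h1 h2, ιπ]
    · exact fun h => h1 (nx.injective h)
    · exact fun h => h2 (nx.injective h)
  have πinj : ∀ e f, π e = π f → e ≠ u → e ≠ nx u → f ≠ u → f ≠ nx u → e = f := by
    intro e f h e1 e2 f1 f2
    by_cases h3 : e = nx (nx u)
    · rw [h3, πw] at h
      rcases πU f h.symm with h | h | h <;> first | contradiction | exact h3.trans h.symm
    · by_cases h4 : f = nx (nx u)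
      · rw [h4, πw] at h
        rcases πU e h with h | h | h <;> first | contradiction | exact h.trans h4.symm
      · rw [← ιπ e e2 h3, h, ιπ f f2 h4]
  obtain ⟨M, hM⟩ := rank_exists (fun e : V => toLex (L' (π e), if e = nx u then 1 else if e = nx (nx u) then 2 else (0 : ℕ)))
  simp only [Prod.Lex.toLex_lt_toLex] at hM
  have T : ∀ p q, π p ≠ π q → (M p < M q ↔ L' (π p) < L' (π q)) := by
    intro p q h
    have : L' (π p) ≠ L' (π q) := fun h' => h (hv'.inj h')
    rw [hM]; simp [this]
  have M1 : M u < M (nx u) := by rw [hM]; right; simp [πu, πv, nuv, huw]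
  have M2 : M (nx u) < M (nx (nx u)) := by rw [hM]; right; simp [πw, πv, nvw, nvw.symm]
  have T1 : ∀ f, f ≠ u → f ≠ nx u → ((M u < M f ↔ M (nx u) < M f) ∧ (M f < M u ↔ M f < M (nx u))) := by
    intro f f1 f2
    by_cases f3 : f = nx (nx u)
    · subst f3
      constructor <;> constructor <;> intro h <;> linarith
    · have : π f ≠ U := fun h => by rcases πU f h with h | h | h <;> contradiction
      rw [T _ _ (by rw [πu]; exact this.symm), T _ _ (by rw [πv]; exact this.symm),
        T _ _ (by rw [πu]; exact this), T _ _ (by rw [πv]; exact this), πu, πv]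
      simp
  have T2 : ∀ f, f ≠ nx (nx u) → f ≠ nx u → ((M (nx u) < M f ↔ M (nx (nx u)) < M f) ∧ (M f < M (nx u) ↔ M f < M (nx (nx u)))) := by
    intro f f1 f2
    by_cases f3 : f = u
    · subst f3
      constructor <;> constructor <;> intro h <;> linarith
    · have : π f ≠ U := fun h => by rcases πU f h with h | h | h <;> contradiction
      rw [T _ _ (by rw [πv]; exact this.symm), T _ _ (by rw [πw]; exact this.symm),
        T _ _ (by rw [πv]; exact this), T _ _ (by rw [πw]; exact this), πw, πv]
      simp
  have Minj : Function.Injective M := by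
    intro e f h
    by_cases h1 : π e = π f
    · by_contra hne
      by_cases hU : π e = U
      · rw [hU] at h1
        rcases πU e hU with h2 | h2 | h2 <;> rcases πU f h1.symm with h3 | h3 | h3 <;> subst h2 <;> subst h3 <;> first | exact hne rfl | linarith
      · have hU' : π f ≠ U := fun h => hU (h1.trans h)
        refine hne (πinj e f h1 ?_ ?_ ?_ ?_) <;> rintro rfl <;> contradiction
    · have a := T e f h1
      have b := T f e (Ne.symm h1)
      have : L' (π e) ≠ L' (π f) := fun h' => h1 (hv'.inj h')
      rw [h] at a b
      simp only [lt_irrefl, false_iff, not_lt] at a b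
      exact absurd (le_antisymm b a) this
  have xn0 : ∀ e, π e ≠ U → x (ι (π e)) = x e := by
    intro e h
    rw [ιπ] <;> rintro rfl <;> contradiction
  have xne' : ∀ i, x (ι i) ≠ x (ι (nx' i)) := fun i h => by
    rcases hz' i with h' | h' <;> simp only at h' <;> linarith [h'.1]
  refine ⟨M, ⟨Minj, ?_, ?_⟩, fun e => if e = nx u then ¬ s' U else s' (π e), ?_, ?_, ?_⟩
  · intro i e hs
    have hsp : (x e ≠ x (nx i) ∧ x (nx e) ≠ x (nx i)) := by
      rcases hs with h | h <;> constructor <;> intro h' <;> linarith [h.1, h.2]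
    by_cases iu : i = u
    · subst iu
      exact (T1 e (fun h => hsp.2 (by rw [h])) (fun h => hsp.1 (by rw [h]))).2
    by_cases iv : i = nx u
    · subst iv
      exact (T2 e (fun h => hsp.1 (by rw [h])) (fun h => hsp.2 (by rw [h]))).2
    have hn := πn i iu iv
    have hx := xn i iu iv
    by_cases eU : π e = U
    · have hs' : x (nx (nx (nx u))) < x (nx i) ∧ x (nx i) < x u := by
        rcases πU e eU with h | h | h <;> subst h <;> rcases hs with h | h <;> constructor <;> linarith [h.1, h.2]
      have c := hv'.h1 (π i) U (by right; simp only [cs.hnU, cs.hU, hx]; exact hs')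
      rw [T, T, eU, hn]
      · exact c
      · rw [eU]; intro h
        rcases πU _ h.symm with h | h | h
        · rw [h] at hs'; linarith
        · exact iu (nx.injective h)
        · exact iv (nx.injective h)
      · rw [eU]; intro h
        rcases πU _ h.symm with h | h | h
        · exact iu h
        · exact iv h
        · rw [h] at hs'; linarith
    · have eu : e ≠ u := by rintro rfl; contradiction
      have ev : e ≠ nx u := by rintro rfl; contradiction
      have c := hv'.h1 (π i) (π e) (by simp only [xn e eu ev, xn0 e eU, hx]; exact hs)
      have n1 : π e ≠ π i := by
        intro h
        have := πinj e i h eu ev iu iv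
        rw [this] at hsp; exact hsp.2 rfl
      have n2 : π e ≠ π (nx i) := by
        intro h
        rw [hn] at h
        have := xn0 e eU
        rw [h, hx] at this
        exact hsp.1 this.symm
      rw [T _ _ n1, T _ _ n2, hn]; exact c
  · intro i j hij hy hor
    have zj := hz j
    have zi := hz i
    by_cases iu : i = u
    · subst iu
      have t1 := T1 j hij.symm (fun h => by rw [h] at hy; linarith)
      have t2 := T1 (nx j) (fun h => by rw [h] at hy; linarith) (fun h => hij.symm (nx.injective h))
      rw [t1.1, t2.1]
    by_cases iv : i = nx u
    · subst iv
      have t1 := T2 j (fun h => by rw [h] at hy; linarith) hij.symm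
      have t2 := T2 (nx j) (fun h => hij.symm (nx.injective h)) (fun h => by rw [h] at hy; linarith)
      rw [t1.1, t2.1]
    by_cases ju : j = u
    · subst ju
      have t1 := T1 i hij (fun h => by rw [h] at hy; linarith)
      have t2 := T1 (nx i) (fun h => by rw [h] at hy; linarith) (fun h => hij (nx.injective h))
      rw [t1.2, t2.2]; exact ⟨fun _ => Iff.rfl, fun _ => Iff.rfl⟩
    by_cases jv : j = nx u
    · subst jv
      have t1 := T2 i (fun h => by rw [h] at hy; linarith) hij
      have t2 := T2 (nx i) (fun h => hij (nx.injective h)) (fun h => by rw [h] at hy; linarith)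
      rw [t1.2, t2.2]; exact ⟨fun _ => Iff.rfl, fun _ => Iff.rfl⟩
    have hin := πn i iu iv
    have hix := xn i iu iv
    have hjn := πn j ju jv
    have hjx := xn j ju jv
    have nij : π i ≠ π j := fun h => hij (πinj i j h iu iv ju jv)
    have ori : ∀ i, i ≠ u → i ≠ nx u → (x (ι (π i)) < x (ι (nx' (π i))) ↔ x i < x (nx i)) := by
      intro i iu iv
      rw [xn i iu iv]
      by_cases iw : i = nx (nx u)
      · rw [iw, πw, cs.hU]
        constructor <;> intro h <;> linarith
      · rw [ιπ i iv iw]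
    have c := hv'.h2 (π i) (π j) nij (by simp only [hix, hjx, hy]) (by simp only [ori i iu iv, ori j ju jv, hor])
    have n2 : nx' (π i) ≠ nx' (π j) := fun h => nij (nx'.injective h)
    have n3 : π i ≠ nx' (π j) := fun h => xne' (π i) (by rw [hix, hy, ← hjx, ← h])
    have n4 : nx' (π i) ≠ π j := fun h => xne' (π j) (by rw [hjx, ← hy, ← hix, ← h])
    rw [T _ _ nij, T i (nx j) (by rw [hjn]; exact n3), T (nx i) j (by rw [hin]; exact n4), T (nx i) (nx j) (by rw [hin, hjn]; exact n2), hin, hjn]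
    exact c
  · intro i
    by_cases iu : i = u
    · subst iu; simp [nuv, πu]
    by_cases iv : i = nx u
    · subst iv; simp [nvw.symm, πw]
    · have : nx i ≠ nx u := fun h => iu (nx.injective h)
      simp only [this, iv, if_false]
      rw [πn i iu iv, hs.1]
  · intro i
    by_cases iu : i = u
    · subst iu; simp [nuv, πu, M1, hup]
    by_cases iv : i = nx u
    · subst iv; simp only [if_true, M2, iff_true]; rw [← hup, hμ, not_not]
    · have h1 : nx i ≠ nx u := fun h => iu (nx.injective h)
      have h2 : nx i ≠ nx (nx u) := fun h => iv (nx.injective h)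
      simp only [iv, if_false]
      have a := hs.2.1 (π i)
      rw [← πn i iu iv] at a
      simp only [ιπ _ h1 h2] at a
      rw [a, T]
      rw [πn i iu iv]
      intro h
      exact xne' (π i) (by rw [← h])
  · obtain ⟨t', ht', hst'⟩ := hs.2.2
    have TT : ∀ j t, π t = t' → π j ≠ π t → M j ≤ M t := by
      intro j t h1 h2
      have := T t j h2.symm
      by_contra h
      rw [not_le, this, h1] at h
      linarith [ht' (π j)]
    by_cases hU : t' = U
    · subst hU
      refine ⟨nx (nx u), fun j => ?_, by simp [nvw.symm, πw, hst']⟩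
      by_cases h : π j = t'
      · rcases πU j h with h | h | h <;> subst h <;> linarith
      · exact TT _ _ πw (by rw [πw]; exact h)
    · refine ⟨ι t', fun j => ?_, by simp [cs.hv, hπ, hst']⟩
      by_cases h : π j = t'
      · rw [← h, ιπ]
        · rintro rfl; exact hU (h ▸ πv)
        · rintro rfl; exact hU (h ▸ πw)
      · exact TT _ _ (hπ _) (by rw [hπ]; exact h)

lemma crimp_rev {nx : Equiv.Perm V} {nx' : Equiv.Perm V'} {ι : V' → V} {u : V} {U : V'}
    (cs : CS nx nx' ι u U) {x : V → ℝ} (hz : Zig nx x)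
    (hz' : Zig nx' (fun e => x (ι e))) (hc' : Conn nx')
    (hab : x (nx u) < x (nx (nx u))) (hb : x (nx (nx u)) ≤ x u)
    (ha : x (nx (nx (nx u))) ≤ x (nx u)) (huw : u ≠ nx (nx u)) {μ : V → Prop} {ε : Prop}
    (hμ : μ (nx u) ↔ ¬ μ (nx (nx u))) (hf : FF nx' (fun e => x (ι e)) (fun e => μ (ι e)) ε) :
    FF nx x μ ε := by
  obtain ⟨L, hv, s, hs⟩ := hf
  by_cases h : μ (nx u) ↔ s U
  · exact crimp_rev_up cs hz hz' hv hab hb ha huw hμ hs h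
  · exact crimp_rev_up cs hz hz' (hv.negL hz') hab hb ha huw hμ (hs.negL hv hz' hc') (by tauto)

/-- crimp equivalence, both orientations -/
lemma crimp_iff {nx : Equiv.Perm V} {nx' : Equiv.Perm V'} {ι : V' → V} {u : V} {U : V'}
    (cs : CS nx nx' ι u U) {x : V → ℝ} (hz : Zig nx x) (hc : Conn nx)
    (hz' : Zig nx' (fun e => x (ι e))) (hc' : Conn nx')
    (hg : (x (nx u) < x (nx (nx u)) ∧ x (nx (nx u)) ≤ x u ∧ x (nx (nx (nx u))) ≤ x (nx u)) ∨
      (x (nx (nx u)) < x (nx u) ∧ x u ≤ x (nx (nx u)) ∧ x (nx u) ≤ x (nx (nx (nx u)))))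
    (huw : u ≠ nx (nx u)) {μ : V → Prop} {ε : Prop}
    (hμ : μ (nx u) ↔ ¬ μ (nx (nx u))) :
    FF nx x μ ε ↔ FF nx' (fun e => x (ι e)) (fun e => μ (ι e)) ε := by
  rcases hg with ⟨h1, h2, h3⟩ | ⟨h1, h2, h3⟩
  · exact ⟨crimp_forward cs hz hc hz' hc' h1 h2 h3 hμ, crimp_rev cs hz hz' hc' h1 h2 h3 huw hμ⟩
  · constructor
    · intro h
      have := crimp_forward cs hz.negx hc hz'.negx hc' (neg_lt_neg h1) (neg_le_neg h2) (neg_le_neg h3) hμ (h.negx hz)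
      simpa using this.negx hz'.negx
    · intro h
      have := crimp_rev cs hz.negx hz'.negx hc' (neg_lt_neg h1) (neg_le_neg h2) (neg_le_neg h3) huw hμ (h.negx hz')
      simpa using this.negx hz.negx

end Crimp

namespace Crimp
open Classical

variable {V V' : Type*} [Fintype V] [Fintype V']

lemma spiral_aux {nx : Equiv.Perm V} {x L : V → ℝ} (hv : VL nx x L) (E : ℕ → V)
    (hE : ∀ j, E (j + 1) = nx (E j)) (k : ℕ) (hk : Odd k) (a b : ℝ) (hab : a < b)
    (h0 : b < x (E 0)) (hodd : ∀ j, j ≤ k + 1 → Odd j → x (E j) = a)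
    (heven : ∀ j, j ≤ k + 1 → 1 ≤ j → Even j → x (E j) = b) (hlast : x (E (k + 2)) < a)
    (zz : ∀ j, j < k → (L (E j) < L (E (j + 1)) ↔ ¬ L (E (j + 1)) < L (E (j + 2)))) : False := by
  have k1 : 1 ≤ k := hk.pos
  have ne : ∀ e f, x e ≠ x f → L e ≠ L f := fun e f h h' => h (by rw [hv.inj h'])
  have x1 : x (E 1) = a := hodd 1 (by omega) odd_one
  have x2 : x (E 2) = b := heven 2 (by omega) (by omega) even_two
  have main : ∀ j, j + 2 ≤ k + 1 →
      ((L (E j) < L (E (j + 2)) ∧ L (E (j + 2)) < L (E (j + 1))) ∨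
       (L (E (j + 1)) < L (E (j + 2)) ∧ L (E (j + 2)) < L (E j))) ∧
      ((L (E 0) < L (E (j + 2)) ∧ L (E (j + 2)) < L (E 1) ∧ L (E 0) ≤ L (E (j + 1)) ∧ L (E (j + 1)) ≤ L (E 1)) ∨
       (L (E 1) < L (E (j + 2)) ∧ L (E (j + 2)) < L (E 0) ∧ L (E 1) ≤ L (E (j + 1)) ∧ L (E (j + 1)) ≤ L (E 0))) := by
    intro j
    induction j with
    | zero =>
      intro hj
      have h := hv.h1 (E 1) (E 0)
      rw [← hE, ← hE] at h
      norm_num at h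
      rw [x1, x2] at h
      have h := h (Or.inr ⟨hab, h0⟩)
      have z := zz 0 (by omega)
      have n1 := ne (E 0) (E 1) (by rw [x1]; linarith)
      have n2 := ne (E 0) (E 2) (by rw [x2]; linarith)
      have n3 := ne (E 1) (E 2) (by rw [x1, x2]; linarith)
      norm_num at z ⊢
      clear zz ne hE
      rcases lt_or_gt_of_ne n1 with h1 | h1
      · have a1 := z.1 h1
        have a2 := h.1 h1
        exact ⟨Or.inl ⟨a2, lt_of_le_of_ne a1 n3.symm⟩, Or.inl ⟨a2, lt_of_le_of_ne a1 n3.symm, h1.le⟩⟩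
      · have a1 : ¬ L (E 2) ≤ L (E 1) := fun hh => absurd (z.2 hh) (not_lt.2 h1.le)
        have a2 : ¬ L (E 0) < L (E 2) := fun hh => absurd (h.2 hh) (not_lt.2 h1.le)
        exact ⟨Or.inr ⟨not_le.1 a1, lt_of_le_of_ne (not_lt.1 a2) n2.symm⟩, Or.inr ⟨not_le.1 a1, lt_of_le_of_ne (not_lt.1 a2) n2.symm, h1.le⟩⟩
    | succ j ih =>
      intro hj
      obtain ⟨i1, i2⟩ := ih (by omega)
      have hx : x (E (j + 1)) = x (E (j + 3)) ∧ x (E (j + 2)) ≠ x (E (j + 3)) ∧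
          (x (E j) < x (E (j + 1)) ↔ x (E (j + 2)) < x (E (j + 3))) := by
        rcases Nat.even_or_odd j with hj' | hj'
        · have e1 : x (E (j + 1)) = a := hodd _ (by omega) (by grind)
          have e2 : x (E (j + 2)) = b := heven _ (by omega) (by omega) (by grind)
          have e3 : x (E (j + 3)) = a := hodd _ (by omega) (by grind)
          have e0 : b ≤ x (E j) := by
            rcases Nat.eq_zero_or_pos j with h | h
            · rw [h]; exact h0.le
            · rw [heven j (by omega) h hj']
          rw [e1, e2, e3]
          refine ⟨rfl, hab.ne', ?_⟩
          constructor <;> intro h <;> linarith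
        · have e1 : x (E (j + 1)) = b := heven _ (by omega) (by omega) (by grind)
          have e2 : x (E (j + 2)) = a := hodd _ (by omega) (by grind)
          have e3 : x (E (j + 3)) = b := heven _ (by omega) (by omega) (by grind)
          have e0 : x (E j) = a := hodd _ (by omega) hj'
          rw [e1, e2, e3, e0]
          exact ⟨rfl, hab.ne, Iff.rfl⟩
      have hne : E j ≠ E (j + 2) := by
        intro h; rw [← h] at i1; rcases i1 with i | i <;> linarith [i.1, i.2]
      have h := hv.h2 (E j) (E (j + 2)) hne (by rw [← hE, ← hE]; exact hx.1) (by rw [← hE, ← hE]; exact hx.2.2)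
      rw [← hE, ← hE] at h
      have z := zz (j + 1) (by omega)
      have n1 := ne _ _ hx.2.1
      have n2 : L (E (j + 1)) ≠ L (E (j + 3)) := fun h' => by
        have h' := hv.inj h'
        rw [h'] at h z
        have h3 : E j = E (j + 2) := nx.injective (by rw [← hE, ← hE]; exact h')
        exact hne h3
      have n3 : L (E j) ≠ L (E (j + 3)) := fun h' => by
        have h' := hv.inj h'
        have h5 := hx.1
        rw [← h'] at h5
        rw [← h'] at hx
        rcases Nat.eq_zero_or_pos j with h | h
        · subst h; norm_num at h5; rw [x1] at h5; linarith
        · rcases Nat.even_or_odd j with hj' | hj'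
          · rw [heven j (by omega) h hj', hodd (j+1) (by omega) (by grind)] at h5; linarith
          · rw [hodd j (by omega) hj', heven (j+1) (by omega) (by omega) (by grind)] at h5; linarith
      have c : (L (E (j + 1)) < L (E (j + 3)) ∧ L (E (j + 3)) < L (E (j + 2))) ∨
          (L (E (j + 2)) < L (E (j + 3)) ∧ L (E (j + 3)) < L (E (j + 1))) := by
        have e12 : j + 1 + 1 = j + 2 := rfl
        have e13 : j + 1 + 2 = j + 3 := rfl
        have e23 : j + 2 + 1 = j + 3 := rfl
        rw [e23] at h
        rw [e12, e13] at z
        clear zz ne hE hx heven hodd i2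
        generalize L (E j) = p0 at *
        generalize L (E (j + 1)) = p1 at *
        generalize L (E (j + 2)) = p2 at *
        generalize L (E (j + 3)) = p3 at *
        grind
      refine ⟨c, ?_⟩
      have e13 : j + 1 + 2 = j + 3 := rfl
      rw [e13]
      have e12 : j + 1 + 1 = j + 2 := rfl
      rw [e12]
      rcases i2 with i | i
      · left; rcases c with c | c <;> refine ⟨?_, ?_, ?_, ?_⟩ <;> linarith [c.1, c.2, i.1, i.2.1, i.2.2.1, i.2.2.2]
      · right; rcases c with c | c <;> refine ⟨?_, ?_, ?_, ?_⟩ <;> linarith [c.1, c.2, i.1, i.2.1, i.2.2.1, i.2.2.2]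
  obtain ⟨j, rfl⟩ : ∃ j, k = j + 1 := ⟨k - 1, by omega⟩
  have m := (main j (by omega)).2
  have h := hv.h1 (E 0) (E (j + 2))
  rw [← hE, ← hE] at h
  norm_num at h
  have h := h (by
    right
    have := heven (j + 2) (by omega) (by omega) (by grind)
    have hl : x (E (j + 2 + 1)) < a := hlast
    rw [x1, this]; exact ⟨hl, hab⟩)
  rcases m with m | m
  · have := h.2 m.2.1; linarith [m.1]
  · have := h.1 m.2.1; linarith [m.1]

lemma iff4 (m1 m2 s0 s1 l1 l2 : Prop) (h1 : m1 ↔ m2) (h2 : m1 ↔ (s0 ↔ l1)) (h3 : m2 ↔ (s1 ↔ l2))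
    (h4 : s1 ↔ ¬ s0) : l1 ↔ ¬ l2 := by tauto

lemma spiral {nx : Equiv.Perm V} {x : V → ℝ} (hz : Zig nx x) {μ : V → Prop} {ε : Prop} (E : ℕ → V)
    (hE : ∀ j, E (j + 1) = nx (E j)) (k : ℕ) (hk : Odd k) (a b : ℝ)
    (hodd : ∀ j, j ≤ k + 1 → Odd j → x (E j) = a)
    (heven : ∀ j, j ≤ k + 1 → 1 ≤ j → Even j → x (E j) = b)
    (hg : (a < b ∧ b < x (E 0) ∧ x (E (k + 2)) < a) ∨ (b < a ∧ x (E 0) < b ∧ a < x (E (k + 2))))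
    (hμ : ∀ j, j < k → (μ (E (j + 1)) ↔ μ (E (j + 2)))) : ¬ FF nx x μ ε := by
  rintro ⟨L, hv, s, hs⟩
  have zz : ∀ j, j < k → (L (E j) < L (E (j + 1)) ↔ ¬ L (E (j + 1)) < L (E (j + 2))) := by
    intro j hj
    have h1 := hμ j hj
    have h2 := hs.2.1 (E j)
    have h3 := hs.2.1 (E (j + 1))
    have h4 := hs.1 (E j)
    rw [← hE] at h2 h3 h4
    have e12 : j + 1 + 1 = j + 2 := rfl
    rw [e12] at h3
    exact iff4 _ _ _ _ _ _ h1 h2 h3 h4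
  rcases hg with ⟨h1, h2, h3⟩ | ⟨h1, h2, h3⟩
  · exact spiral_aux hv E hE k hk a b h1 h2 hodd heven h3 zz
  · exact spiral_aux (hv.negx hz) E hE k hk (-a) (-b) (neg_lt_neg h1) (neg_lt_neg h2)
      (fun j a b => by rw [hodd j a b]) (fun j a b c => by rw [heven j a b c]) (neg_lt_neg h3) zz

end Crimp

namespace Crimp
open Classical

lemma val_succ {N : ℕ} (hN : 2 ≤ N) (e : ZMod N) :
    (e + 1).val = if e.val + 1 = N then 0 else e.val + 1 := by
  haveI : NeZero N := ⟨by omega⟩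
  have h := ZMod.val_lt e
  haveI : Fact (1 < N) := ⟨by omega⟩
  rw [ZMod.val_add, ZMod.val_one]
  split_ifs with h1
  · rw [h1, Nat.mod_self]
  · exact Nat.mod_eq_of_lt (by omega)

lemma conn_zmod {N : ℕ} [NeZero N] : Conn (Equiv.addRight (1 : ZMod N)) := by
  rintro S ⟨e, he⟩ h f
  have : ∀ j : ℕ, S (e + j) := by
    intro j
    induction j with
    | zero => simpa using he
    | succ j ih => have := h _ ih; simpa [add_assoc] using this
  have h2 := this (f - e).val
  simpa using h2

def Alt (N : ℕ) (x : ℕ → ℝ) : Prop := ∀ i < N,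
  (Even i → x i < x ((i + 1) % N)) ∧ (Odd i → x ((i + 1) % N) < x i)

lemma Alt.zig {N : ℕ} {x : ℕ → ℝ} (h : Alt N x) (hN : 2 ≤ N) (he : Even N) :
    Zig (Equiv.addRight (1 : ZMod N)) (fun i => x i.val) := by
  haveI : NeZero N := ⟨by omega⟩
  intro i
  have v : ∀ e : ZMod N, (e + 1).val = (e.val + 1) % N := by
    intro e
    have := ZMod.val_lt e
    rw [val_succ hN]
    split_ifs with h1
    · rw [h1, Nat.mod_self]
    · exact (Nat.mod_eq_of_lt (by omega)).symm
  have h1 := h _ (ZMod.val_lt i)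
  have h2 := h _ (ZMod.val_lt (i + 1))
  simp only [Equiv.coe_addRight]
  rw [v (i + 1)]
  rw [← v i] at h1
  have vs := val_succ hN i
  rcases Nat.even_or_odd i.val with e | e
  · left
    have : Odd (i + 1).val := by rw [vs]; split_ifs <;> grind
    exact ⟨h1.1 e, h2.2 this⟩
  · right
    have : Even (i + 1).val := by rw [vs]; split_ifs <;> grind
    exact ⟨h1.2 e, h2.1 this⟩

def FN (N : ℕ) (x : ℕ → ℝ) (μ : ℕ → Prop) (ε : Prop) : Prop :=
  FF (Equiv.addRight (1 : ZMod N)) (fun i => x i.val) (fun i => μ i.val) ε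

def del {α : Type*} (q : ℕ) (x : ℕ → α) : ℕ → α := fun i => if i ≤ q then x i else x (i + 2)

lemma FN_crimp {N q : ℕ} (hN : 2 ≤ N) (he : Even N) (hq : q < N) {x : ℕ → ℝ} {μ : ℕ → Prop} {ε : Prop}
    (h1 : Alt (N + 2) x) (h2 : Alt N (del q x))
    (hg : (x (q + 1) < x (q + 2) ∧ x (q + 2) ≤ x q ∧ x ((q + 3) % (N + 2)) ≤ x (q + 1)) ∨
      (x (q + 2) < x (q + 1) ∧ x q ≤ x (q + 2) ∧ x (q + 1) ≤ x ((q + 3) % (N + 2))))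
    (hμ : μ (q + 1) ↔ ¬ μ (q + 2)) :
    FN (N + 2) x μ ε ↔ FN N (del q x) (del q μ) ε := by
  haveI : NeZero N := ⟨by omega⟩
  set ι : ZMod N → ZMod (N + 2) := fun e => if e.val ≤ q then (e.val : ZMod (N + 2)) else ((e.val + 2 : ℕ) : ZMod (N + 2)) with hι
  have vι : ∀ e, (ι e).val = if e.val ≤ q then e.val else e.val + 2 := by
    intro e
    have := ZMod.val_lt e
    simp only [hι]
    split_ifs
    · exact ZMod.val_cast_of_lt (by omega)
    · exact ZMod.val_cast_of_lt (by omega)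
  have vq : ((q : ℕ) : ZMod (N + 2)).val = q := ZMod.val_cast_of_lt (by omega)
  have vq' : ((q : ℕ) : ZMod N).val = q := ZMod.val_cast_of_lt (by omega)
  have vs := @val_succ (N + 2) (by omega)
  have vs' := @val_succ N (by omega)
  have vu1 : ((q : ZMod (N + 2)) + 1).val = q + 1 := by rw [vs, vq]; split_ifs <;> omega
  have vu2 : ((q : ZMod (N + 2)) + 1 + 1).val = q + 2 := by rw [vs, vu1]; split_ifs <;> omega
  have vu3 : ((q : ZMod (N + 2)) + 1 + 1 + 1).val = (q + 3) % (N + 2) := by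
    rw [vs, vu2]; split_ifs with h
    · rw [show q + 3 = N + 2 by omega, Nat.mod_self]
    · rw [Nat.mod_eq_of_lt (by omega)]
  have cs : CS (Equiv.addRight (1 : ZMod (N + 2))) (Equiv.addRight (1 : ZMod N)) ι (q : ZMod (N + 2)) (q : ZMod N) := by
    constructor
    · intro e f h
      have h := congrArg ZMod.val h
      rw [vι, vι] at h
      apply ZMod.val_injective
      split_ifs at h <;> omega
    · intro e h
      have h := congrArg ZMod.val h
      simp only [Equiv.coe_addRight] at h
      rw [vι, vu1] at h
      split_ifs at h <;> omega
    · intro e h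
      have h := congrArg ZMod.val h
      simp only [Equiv.coe_addRight] at h
      rw [vι, vu2] at h
      split_ifs at h <;> omega
    · intro e e1 e2
      simp only [Equiv.coe_addRight] at e1 e2
      have e1 : e.val ≠ q + 1 := fun h => e1 (ZMod.val_injective _ (by rw [vu1, h]))
      have e2 : e.val ≠ q + 2 := fun h => e2 (ZMod.val_injective _ (by rw [vu2, h]))
      have hlt := ZMod.val_lt e
      by_cases h : e.val ≤ q
      · refine ⟨(e.val : ZMod N), ZMod.val_injective _ ?_⟩
        rw [vι, ZMod.val_cast_of_lt (by omega), if_pos h]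
      · refine ⟨((e.val - 2 : ℕ) : ZMod N), ZMod.val_injective _ ?_⟩
        rw [vι, ZMod.val_cast_of_lt (by omega), if_neg (by omega)]
        omega
    · apply ZMod.val_injective
      rw [vι, vq', vq, if_pos le_rfl]
    · intro e h
      have h : e.val ≠ q := fun h' => h (ZMod.val_injective _ (by rw [vq', h']))
      have hlt := ZMod.val_lt e
      apply ZMod.val_injective
      simp only [Equiv.coe_addRight]
      rw [vι, vs', vs, vι]
      split_ifs <;> omega
    · apply ZMod.val_injective
      simp only [Equiv.coe_addRight]
      rw [vι, vs', vq', vs, vu2]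
      split_ifs <;> omega
  have ex : (fun e => x (ι e).val) = (fun i : ZMod N => del q x i.val) := by
    funext e
    rw [vι]; unfold del; split_ifs <;> rfl
  have em : (fun e => μ (ι e).val) = (fun i : ZMod N => del q μ i.val) := by
    funext e
    rw [vι]; unfold del; split_ifs <;> rfl
  have main := crimp_iff cs (x := fun i => x i.val) (h1.zig (by omega) (by grind)) conn_zmod
    (by rw [ex]; exact h2.zig hN he) conn_zmod
    (by simp only [Equiv.coe_addRight]; rw [vu1, vu2, vu3, vq]; exact hg)
    (by
      intro h
      have h := congrArg ZMod.val h
      simp only [Equiv.coe_addRight] at h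
      rw [vq, vu2] at h; omega)
    (μ := fun i => μ i.val) (ε := ε)
    (by simp only [Equiv.coe_addRight]; rw [vu1, vu2]; exact hμ)
  unfold FN
  rw [main, ex, em]

lemma FN_congr {N : ℕ} [NeZero N] {x x' : ℕ → ℝ} {μ μ' : ℕ → Prop} {ε : Prop}
    (hx : ∀ i < N, x i = x' i) (hμ : ∀ i < N, (μ i ↔ μ' i)) : FN N x μ ε ↔ FN N x' μ' ε := by
  unfold FN
  have e1 : (fun i : ZMod N => x i.val) = fun i : ZMod N => x' i.val := funext fun i => hx _ (ZMod.val_lt i)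
  have e2 : (fun i : ZMod N => μ i.val) = fun i : ZMod N => μ' i.val := funext fun i => propext (hμ _ (ZMod.val_lt i))
  rw [e1, e2]

lemma count_del (f : ℕ → ℕ) (j d : ℕ) :
    ∑ i ∈ Finset.range (j + d + 2), f i =
      ∑ i ∈ Finset.range (j + d), (if i < j then f i else f (i + 2)) + f j + f (j + 1) := by
  induction d with
  | zero =>
    rw [Finset.sum_range_succ, Finset.sum_range_succ]
    congr 2
    exact Finset.sum_congr rfl fun i hi => by rw [if_pos (by simpa using hi)]
  | succ d ih =>
    rw [show j + (d + 1) + 2 = (j + d + 2) + 1 by ring, Finset.sum_range_succ, ih,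
      show j + (d + 1) = (j + d) + 1 by ring, Finset.sum_range_succ, if_neg (by omega)]
    ring

structure Run (p k : ℕ) (a b : ℝ) (x : ℕ → ℝ) : Prop where
  alt : ∀ i < p, (Even i → x i < x (i + 1)) ∧ (Odd i → x (i + 1) < x i)
  hab : a < b
  hp : b < x p
  h0 : x 0 < a
  ev : ∀ j ≤ k, Even j → x (p + 1 + j) = a
  od : ∀ j ≤ k, Odd j → x (p + 1 + j) = b

lemma Run.del {p k j : ℕ} {a b : ℝ} {x : ℕ → ℝ} (h : Run p (k + 2) a b x) :
    Run p k a b (del (p + j) x) := by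
  have hp0 : Crimp.del (p + j) x p = x p := by simp [Crimp.del]
  have h00 : Crimp.del (p + j) x 0 = x 0 := by simp [Crimp.del]
  refine ⟨?_, h.hab, by rw [hp0]; exact h.hp, by rw [h00]; exact h.h0, ?_, ?_⟩
  · intro i hi
    have := h.alt i hi
    unfold Crimp.del
    rw [if_pos (by omega), if_pos (by omega)]
    exact this
  · intro i hi e
    unfold Crimp.del
    split_ifs
    · exact h.ev i (by omega) e
    · exact h.ev (i + 2) (by omega) (by grind)
  · intro i hi e
    unfold Crimp.del
    split_ifs
    · exact h.od i (by omega) e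
    · exact h.od (i + 2) (by omega) (by grind)

lemma Run.Alt {p k : ℕ} {a b : ℝ} {x : ℕ → ℝ} (h : Run p k a b x) (hp : Odd p) (hk : Odd k) :
    Alt (p + k + 2) x := by
  intro i hi
  rcases lt_trichotomy i p with h1 | h1 | h1
  · rw [Nat.mod_eq_of_lt (by omega)]; exact h.alt i h1
  · subst h1
    rw [Nat.mod_eq_of_lt (by omega)]
    have := h.ev 0 (by omega) (by simp)
    rw [add_zero] at this
    refine ⟨fun h' => ?_, fun _ => by rw [this]; linarith [h.hab, h.hp]⟩
    grind
  · obtain ⟨j, rfl⟩ : ∃ j, i = p + 1 + j := ⟨i - (p + 1), by omega⟩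
    rcases Nat.lt_or_ge j k with hj | hj
    · rw [Nat.mod_eq_of_lt (by omega)]
      constructor
      · intro e
        rw [h.ev j hj.le (by grind), add_assoc (p + 1), h.od (j + 1) (by omega) (by grind)]
        exact h.hab
      · intro e
        rw [h.od j hj.le (by grind), add_assoc (p + 1), h.ev (j + 1) (by omega) (by grind)]
        exact h.hab
    · have : j = k := by omega
      subst this
      rw [show p + 1 + j + 1 = p + j + 2 by ring, Nat.mod_self]
      constructor
      · intro e; grind
      · intro e
        rw [h.od j le_rfl hk]; linarith [h.hab, h.h0]

lemma Run.Alt0 {p k : ℕ} {a b : ℝ} {x : ℕ → ℝ} (h : Run p k a b x) (hp : Odd p) :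
    Crimp.Alt (p + 1) x := by
  intro i hi
  rcases lt_or_eq_of_le (Nat.le_of_lt_succ hi) with h1 | h1
  · rw [Nat.mod_eq_of_lt (by omega)]; exact h.alt i h1
  · subst h1
    rw [Nat.mod_self]
    exact ⟨fun h' => by grind, fun _ => by linarith [h.hab, h.hp, h.h0]⟩

lemma Run.crimp {p k j : ℕ} {a b : ℝ} {x : ℕ → ℝ} (h : Run p k a b x) (hp : Odd p) (hk : Odd k)
    (hj : j < k) {μ : ℕ → Prop} {ε : Prop} (hμ : μ (p + 1 + j) ↔ ¬ μ (p + 1 + (j + 1)))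
    (h2 : Crimp.Alt (p + k) (Crimp.del (p + j) x)) :
    FN (p + k + 2) x μ ε ↔ FN (p + k) (Crimp.del (p + j) x) (Crimp.del (p + j) μ) ε := by
  have h1 := h.Alt hp hk
  apply FN_crimp (by have := hp.pos; have := hk.pos; omega) (by grind) (by omega) h1 h2
  · rcases Nat.even_or_odd j with e | e
    · left
      have a1 := h.ev j hj.le e
      have a2 := h.od (j + 1) (by omega) (by grind)
      rw [show p + j + 1 = p + 1 + j by ring, show p + j + 2 = p + 1 + (j + 1) by ring, a1, a2]
      refine ⟨h.hab, ?_, ?_⟩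
      · rcases Nat.eq_zero_or_pos j with h' | h'
        · subst h'; exact h.hp.le
        · have := h.od (j - 1) (by omega) (by grind)
          rw [show p + 1 + (j - 1) = p + j by omega] at this
          rw [this]
      · by_cases h' : j + 1 = k
        · rw [show p + j + 3 = p + k + 2 by omega, Nat.mod_self]; exact h.h0.le
        · rw [Nat.mod_eq_of_lt (by omega), show p + j + 3 = p + 1 + (j + 2) by ring, h.ev (j + 2) (by omega) (by grind)]
    · right
      have a1 := h.od j hj.le e
      have a2 := h.ev (j + 1) (by omega) (by grind)
      rw [show p + j + 1 = p + 1 + j by ring, show p + j + 2 = p + 1 + (j + 1) by ring, a1, a2]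
      refine ⟨h.hab, ?_, ?_⟩
      · have := h.ev (j - 1) (by omega) (by grind)
        rw [show p + 1 + (j - 1) = p + j by grind] at this
        rw [this]
      · have : j + 2 ≤ k := by grind
        rw [Nat.mod_eq_of_lt (by omega), show p + j + 3 = p + 1 + (j + 2) by ring, h.od (j + 2) (by omega) (by grind)]
  · rw [show p + j + 1 = p + 1 + j by ring, show p + j + 2 = p + 1 + (j + 1) by ring]; exact hμ

lemma cnt_del {p k j : ℕ} (hj : j ≤ k) {μ : ℕ → Prop} (hμ : μ (p + 1 + j) ↔ ¬ μ (p + 1 + (j + 1))) :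
    ∑ i ∈ Finset.range (k + 2), (if μ (p + 1 + i) then 1 else 0) =
      ∑ i ∈ Finset.range k, (if Crimp.del (p + j) μ (p + 1 + i) then 1 else 0) + 1 := by
  obtain ⟨d, rfl⟩ := Nat.exists_eq_add_of_le hj
  rw [count_del, add_assoc]
  congr 1
  · refine Finset.sum_congr rfl fun i _ => ?_
    unfold Crimp.del
    by_cases h : i < j
    · have h' : p + 1 + i ≤ p + j := by omega
      simp only [h, h', if_true]
    · have h' : ¬ p + 1 + i ≤ p + j := by omega
      simp only [h, h', if_false]; rfl
  · by_cases h : μ (p + 1 + j)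
    · simp [h, hμ.1 h]
    · have h' : μ (p + 1 + (j + 1)) := by tauto
      simp [h, h']

lemma Run.no_spiral {p k : ℕ} {a b : ℝ} {x : ℕ → ℝ} (h : Run p k a b x) (hp : Odd p) (hk : Odd k)
    {μ : ℕ → Prop} {ε : Prop} (hμ : ∀ j < k, (μ (p + 1 + j) ↔ μ (p + 1 + (j + 1)))) :
    ¬ FN (p + k + 2) x μ ε := by
  have vc : ∀ i, i < p + k + 2 → ((i : ℕ) : ZMod (p + k + 2)).val = i := fun i hi => ZMod.val_cast_of_lt hi
  refine spiral ((h.Alt hp hk).zig (by omega) (by grind)) (fun j => ((p + j : ℕ) : ZMod (p + k + 2)))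
    (fun j => ?_) k hk a b ?_ ?_ ?_ ?_
  · simp [add_assoc]
  · intro j hj o
    rw [vc _ (by omega)]
    have := h.ev (j - 1) (by omega) (by grind)
    rwa [show p + 1 + (j - 1) = p + j by grind] at this
  · intro j hj h1 o
    rw [vc _ (by omega)]
    have := h.od (j - 1) (by omega) (by grind)
    rwa [show p + 1 + (j - 1) = p + j by omega] at this
  · left
    rw [vc _ (by omega)]
    refine ⟨h.hab, h.hp, ?_⟩
    rw [show p + (k + 2) = p + k + 2 by ring, ZMod.natCast_self]
    rw [ZMod.val_zero]; exact h.h0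
  · intro j hj
    rw [vc _ (by omega), vc _ (by omega)]
    have := hμ j hj
    rwa [show p + 1 + j = p + (j + 1) by ring, show p + 1 + (j + 1) = p + (j + 2) by ring] at this

lemma run_main (p : ℕ) (hp : Odd p) (a b : ℝ) (ε : Prop) (r : ℕ) : ∀ (x : ℕ → ℝ) (μ : ℕ → Prop),
    Run p (2 * r + 1) a b x →
    (FN (p + (2 * r + 1) + 2) x μ ε ↔
      (∑ j ∈ Finset.range (2 * r + 2), (if μ (p + 1 + j) then 1 else 0)) = r + 1 ∧ FN (p + 1) x μ ε) := by
  induction r with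
  | zero =>
    intro x μ h
    by_cases hμ : μ (p + 1 + 0) ↔ ¬ μ (p + 1 + (0 + 1))
    · have h0 : Crimp.Alt (p + 1) (Crimp.del (p + 0) x) := by
        have h2 := h.Alt0 hp
        intro i hi
        have := h2 i hi
        have hm : (i + 1) % (p + 1) < p + 1 := Nat.mod_lt _ (by omega)
        unfold Crimp.del
        rw [if_pos (by omega), if_pos (by omega)]
        exact this
      have c := h.crimp hp (by decide) (j := 0) (by omega) (μ := μ) (ε := ε) hμ h0
      rw [c, FN_congr (N := p + (2 * 0 + 1)) (x' := x) (μ' := μ)]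
      · constructor
        · intro h
          refine ⟨?_, h⟩
          rw [cnt_del (k := 0) (j := 0) le_rfl hμ]; simp
        · exact fun h => h.2
      · intro i hi; unfold Crimp.del; rw [if_pos (by omega)]
      · intro i hi; unfold Crimp.del; rw [if_pos (by omega)]
    · have := h.no_spiral hp (by decide) (μ := μ) (ε := ε) (fun j hj => by
        have : j = 0 := by omega
        subst this; tauto)
      constructor
      · intro h; exact absurd h this
      · rintro ⟨h, -⟩
        exfalso
        simp only [Finset.sum_range_succ, Finset.sum_range_zero] at h
        by_cases h1 : μ (p + 1 + 0) <;> by_cases h2 : μ (p + 1 + 1) <;> simp_all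
  | succ r ih =>
    intro x μ h
    by_cases hμ : ∃ j < 2 * (r + 1) + 1, (μ (p + 1 + j) ↔ ¬ μ (p + 1 + (j + 1)))
    · obtain ⟨j, hj, hμ⟩ := hμ
      have hd : Run p (2 * r + 1) a b (Crimp.del (p + j) x) := Run.del (k := 2 * r + 1) h
      have c := h.crimp hp (by grind) hj (μ := μ) (ε := ε) hμ (hd.Alt hp (by grind))
      have i := ih _ (Crimp.del (p + j) μ) hd
      rw [c, show p + (2 * (r + 1) + 1) = p + (2 * r + 1) + 2 by ring, i]
      rw [FN_congr (N := p + 1) (x' := x) (μ' := μ), show 2 * (r + 1) + 2 = (2 * r + 2) + 2 by ring,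
        cnt_del (k := 2 * r + 2) (j := j) (by omega) hμ, Nat.add_right_cancel_iff]
      · intro i hi; unfold Crimp.del; rw [if_pos (by omega)]
      · intro i hi; unfold Crimp.del; rw [if_pos (by omega)]
    · push Not at hμ
      have hμ : ∀ j < 2 * (r + 1) + 1, (μ (p + 1 + j) ↔ μ (p + 1 + (j + 1))) := fun j hj => by
        have := hμ j hj; tauto
      have := h.no_spiral hp (by grind) (μ := μ) (ε := ε) hμ
      constructor
      · intro h; exact absurd h this
      · rintro ⟨h, -⟩
        exfalso
        have all : ∀ j < 2 * (r + 1) + 2, (μ (p + 1 + j) ↔ μ (p + 1)) := by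
          intro j
          induction j with
          | zero => intro _; rfl
          | succ j ih => intro hj; rw [← hμ j (by omega), ih (by omega)]
        rw [Finset.sum_congr rfl (g := fun _ => if μ (p + 1) then 1 else 0) (fun j hj => by
          simp only [all j (by simpa using hj)])] at h
        simp only [Finset.sum_const, Finset.card_range, smul_eq_mul] at h
        split_ifs at h <;> omega

end Crimp

namespace Crimp
open Classical

lemma mem_betw (p q y : ℝ) : y ∈ betw p q ↔ (p < y ∧ y < q) ∨ (q < y ∧ y < p) := by
  unfold betw
  rw [Set.mem_Ioo, min_lt_iff, lt_max_iff]
  constructor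
  · rintro ⟨h1 | h1, h2 | h2⟩
    · exfalso; linarith
    · exact Or.inl ⟨h1, h2⟩
    · exact Or.inr ⟨h1, h2⟩
    · exfalso; linarith
  · rintro (h | h)
    · exact ⟨Or.inl h.1, Or.inr h.2⟩
    · exact ⟨Or.inr h.1, Or.inl h.2⟩

lemma betw_comm (p q : ℝ) : betw p q = betw q p := by
  unfold betw; rw [min_comm, max_comm]

def Lam (p q r s : ℝ) : Prop :=
  Disjoint (betw p q) (betw r s) ∨ betw p q ⊆ betw r s ∨ betw r s ⊆ betw p q

lemma lam1 {p q r s : ℝ} (h1 : p < q) (h2 : r < s) (a : p ≠ r) (b : p ≠ s) (c : q ≠ r) (d : q ≠ s) :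
    Lam p q r s ↔ ((p < r ↔ p < s) ↔ (q < r ↔ q < s)) := by
  unfold Lam betw
  rw [min_eq_left h1.le, min_eq_left h2.le, max_eq_right h1.le, max_eq_right h2.le,
    Set.Ioo_disjoint_Ioo, Set.Ioo_subset_Ioo_iff h1, Set.Ioo_subset_Ioo_iff h2, min_le_iff, le_max_iff, le_max_iff]
  grind

lemma pl1 (A B C D : Prop) : ((A ↔ B) ↔ (C ↔ D)) ↔ ((B ↔ A) ↔ (D ↔ C)) := by
  rw [Iff.comm (a := A), Iff.comm (a := C)]

lemma pl2 (A B C D : Prop) : ((A ↔ B) ↔ (C ↔ D)) ↔ ((C ↔ D) ↔ (A ↔ B)) := Iff.comm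

lemma lam {p q r s : ℝ} (h1 : p ≠ q) (h2 : r ≠ s) (a : p ≠ r) (b : p ≠ s) (c : q ≠ r) (d : q ≠ s) :
    Lam p q r s ↔ ((p < r ↔ p < s) ↔ (q < r ↔ q < s)) := by
  rcases lt_or_gt_of_ne h1 with h1 | h1 <;> rcases lt_or_gt_of_ne h2 with h2 | h2
  · exact lam1 h1 h2 a b c d
  · have := lam1 h1 h2 b a d c
    unfold Lam at this ⊢
    rw [betw_comm r s, this]; exact pl1 _ _ _ _
  · have := lam1 h1 h2 c d a b
    unfold Lam at this ⊢
    rw [betw_comm p q, this]; exact pl2 _ _ _ _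
  · have := lam1 h1 h2 d c b a
    unfold Lam at this ⊢
    rw [betw_comm p q, betw_comm r s, this]; exact (pl1 _ _ _ _).trans (pl2 _ _ _ _)

lemma sign_eq {a b : ℝ} (ha : a ≠ 0) (hb : b ≠ 0) : Real.sign a = Real.sign b ↔ (0 < a ↔ 0 < b) := by
  rcases lt_or_gt_of_ne ha with h | h <;> rcases lt_or_gt_of_ne hb with h' | h' <;>
    simp [Real.sign_of_neg, Real.sign_of_pos, h, h', h.le, h'.le, not_lt.2] <;> norm_num

lemma VL_iff {n : ℕ} {x L : ZMod n → ℝ} (hz : Zig (Equiv.addRight (1 : ZMod n)) x) :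
    ValidLayering n x L ↔ VL (Equiv.addRight (1 : ZMod n)) x L := by
  have xne : ∀ i : ZMod n, x i ≠ x (i + 1) := fun i h => by
    rcases hz i with h' | h' <;> simp only [Equiv.coe_addRight] at h' <;> linarith [h'.1]
  have main : Function.Injective L → (ValidLayering n x L ↔ VL (Equiv.addRight (1 : ZMod n)) x L) := by
    intro hi
    have ne : ∀ e f, x e ≠ x f → L e ≠ L f := fun e f h h' => h (by rw [hi h'])
    have e1 : (∀ i e : ZMod n, x i ∈ betw (x e) (x (e + 1)) → L e ∉ betw (L (i - 1)) (L i)) ↔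
        (∀ i e : ZMod n, ((x e < x (i + 1) ∧ x (i + 1) < x (e + 1)) ∨ (x (e + 1) < x (i + 1) ∧ x (i + 1) < x e)) →
          (L e < L i ↔ L e < L (i + 1))) := by
      rw [← (Equiv.addRight (1 : ZMod n)).forall_congr_right]
      refine forall_congr' fun i => forall_congr' fun e => ?_
      simp only [Equiv.coe_addRight, add_sub_cancel_right, mem_betw]
      refine imp_congr_right fun h => ?_
      have n1 : L e ≠ L (i + 1) := ne _ _ (by intro h'; rcases h with h | h <;> linarith [h.1, h.2])
      have n2 : L e ≠ L i := fun h' => by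
        rw [hi h'] at h; rcases h with h | h <;> linarith [h.1, h.2]
      grind
    have e2 : (∀ i j : ZMod n, i ≠ j → x i = x j →
        Real.sign (x (i + 1) - x i) = Real.sign (x (j + 1) - x j) → Lam (L (i - 1)) (L i) (L (j - 1)) (L j)) ↔
        (∀ i j : ZMod n, i ≠ j → x (i + 1) = x (j + 1) → (x i < x (i + 1) ↔ x j < x (j + 1)) →
          ((L i < L j ↔ L i < L (j + 1)) ↔ (L (i + 1) < L j ↔ L (i + 1) < L (j + 1)))) := by
      rw [← (Equiv.addRight (1 : ZMod n)).forall_congr_right]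
      refine forall_congr' fun i => ?_
      rw [← (Equiv.addRight (1 : ZMod n)).forall_congr_right]
      refine forall_congr' fun j => ?_
      simp only [Equiv.coe_addRight, add_sub_cancel_right, ne_eq, add_left_inj]
      refine imp_congr_right fun hij => imp_congr_right fun hy => ?_
      have zi := hz i
      have zj := hz j
      simp only [Equiv.coe_addRight] at zi zj
      have s1 : Real.sign (x (i + 1 + 1) - x (i + 1)) = Real.sign (x (j + 1 + 1) - x (j + 1)) ↔
          (x i < x (i + 1) ↔ x j < x (j + 1)) := by
        rw [sign_eq (sub_ne_zero.2 (xne _).symm) (sub_ne_zero.2 (xne _).symm), sub_pos, sub_pos]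
        have a1 : x (i + 1) < x (i + 1 + 1) ↔ ¬ x i < x (i + 1) := by
          rcases zi with h | h <;> constructor <;> intro h' <;> linarith [h.1, h.2]
        have a2 : x (j + 1) < x (j + 1 + 1) ↔ ¬ x j < x (j + 1) := by
          rcases zj with h | h <;> constructor <;> intro h' <;> linarith [h.1, h.2]
        rw [a1, a2]; tauto
      rw [s1]
      refine imp_congr_right fun _ => ?_
      exact lam (ne _ _ (xne i)) (ne _ _ (xne j)) (fun h => hij (hi h)) (ne _ _ (by rw [← hy]; exact xne i))
        (ne _ _ (by rw [hy]; exact (xne j).symm)) (fun h => hij (by simpa using hi h))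
    constructor
    · rintro ⟨h0, h1, h2⟩
      exact ⟨hi, e1.1 h1, e2.1 h2⟩
    · rintro ⟨h0, h1, h2⟩
      exact ⟨hi, e1.2 h1, e2.2 h2⟩
  constructor
  · intro h; exact (main h.1).1 h
  · intro h; exact (main h.inj).2 h

lemma sgn_iff {s l : ℝ} (hs : s = 1 ∨ s = -1) (hl : l ≠ 0) : s = Real.sign l ↔ (s = 1 ↔ 0 < l) := by
  rcases lt_or_gt_of_ne hl with h | h
  · rw [Real.sign_of_neg h]
    rcases hs with rfl | rfl
    · simp [not_lt.2 h.le]; norm_num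
    · simp [not_lt.2 h.le]; norm_num
      try exact h.le
  · rw [Real.sign_of_pos h]
    simp [h]

lemma RL_iff {n : ℕ} {L : ZMod n → ℝ} (hL : ∀ i, L i ≠ L (i + 1)) (μ : ZMod n → MV) (d : Des) :
    Realizes n L μ (epsOf d) ↔
      ∃ s, RL (Equiv.addRight (1 : ZMod n)) L (fun i => μ i = MV.valley) (d = Des.exterior) s := by
  have hm1 : (-1 : ℝ) ≠ 1 := by norm_num
  have heps : ∀ s : ℝ, (s = 1 ∨ s = -1) → (s = epsOf d ↔ (s = 1 ↔ d = Des.exterior)) := by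
    intro s hs
    cases d
    · rcases hs with rfl | rfl <;> simp [epsOf, hm1, hm1.symm]
    · rcases hs with rfl | rfl <;> simp [epsOf, hm1]
  constructor
  · rintro ⟨t, ht, s, h1, h2, h3, h4⟩
    refine ⟨fun i => s i = 1, fun i => ?_, fun i => ?_, t, ht, (heps _ (h1 t)).1 h3⟩
    · simp only [Equiv.coe_addRight]
      rw [h2]
      rcases h1 i with h | h <;> rw [h] <;> simp [hm1]
    · simp only [Equiv.coe_addRight]
      rw [h4, add_sub_cancel_right, sgn_iff (h1 i) (sub_ne_zero.2 (hL i).symm), sub_pos]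
  · rintro ⟨s, h2, h4, t, ht, h3⟩
    simp only [Equiv.coe_addRight] at h2 h4
    have h1 : ∀ i, (if s i then (1 : ℝ) else -1) = 1 ∨ (if s i then (1 : ℝ) else -1) = -1 := by
      intro i; by_cases h : s i <;> simp [h]
    have h1' : ∀ i, (if s i then (1 : ℝ) else -1) = 1 ↔ s i := by
      intro i; by_cases h : s i <;> simp [h, hm1]
    refine ⟨t, ht, fun i => if s i then 1 else -1, h1, fun i => ?_, ?_, fun i => ?_⟩
    · simp only [h2]
      by_cases h : s i <;> simp [h]
    · exact (heps _ (h1 t)).2 (by rw [h1']; exact h3)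
    · have := h4 (i - 1)
      have hl := hL (i - 1)
      rw [sub_add_cancel] at this hl
      rw [this, sgn_iff (h1 _) (sub_ne_zero.2 hl.symm), sub_pos, h1']

lemma folded_step {n : ℕ} {θ : ZMod n → ℝ} (hcc : IsClosedCycle n θ) (i : ZMod n) :
    foldedX n θ (i + 1) = foldedX n θ i + (-1) ^ i.val * θ i := by
  obtain ⟨he, hn, hpos, hsum⟩ := hcc
  haveI : NeZero n := ⟨by omega⟩
  unfold foldedX
  rw [val_succ hn]
  split_ifs with h
  · have hr : Finset.range n = Finset.range (i.val + 1) := by rw [h]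
    rw [hr, Finset.sum_range_succ] at hsum
    rw [ZMod.natCast_zmod_val] at hsum
    rw [hsum]; simp
  · rw [Finset.sum_range_succ, ZMod.natCast_zmod_val]

lemma parity_succ {n : ℕ} (hn : 2 ≤ n) (he : Even n) (i : ZMod n) : (-1 : ℝ) ^ (i + 1).val = - (-1) ^ i.val := by
  rw [val_succ hn]
  split_ifs with h
  · have : Odd i.val := by grind
    rw [this.neg_one_pow]; simp
  · rw [pow_succ]; ring

lemma folded_zig {n : ℕ} {θ : ZMod n → ℝ} (hcc : IsClosedCycle n θ) :
    Zig (Equiv.addRight (1 : ZMod n)) (foldedX n θ) := by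
  intro i
  have h1 := folded_step hcc i
  have h2 := folded_step hcc (i + 1)
  rw [parity_succ hcc.2.1 hcc.1] at h2
  have p1 := hcc.2.2.1 i
  have p2 := hcc.2.2.1 (i + 1)
  simp only [Equiv.coe_addRight]
  rcases neg_one_pow_eq_or ℝ i.val with h | h
  · rw [h] at h1 h2; left; constructor <;> linarith
  · rw [h] at h1 h2; right; constructor <;> linarith

lemma flat_iff {n : ℕ} {θ : ZMod n → ℝ} (hcc : IsClosedCycle n θ) (μ : ZMod n → MV) (d : Des) :
    FlatFoldable n θ μ d ↔ FF (Equiv.addRight (1 : ZMod n)) (foldedX n θ) (fun i => μ i = MV.valley) (d = Des.exterior) := by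
  have hz := folded_zig hcc
  unfold FlatFoldable FF
  refine exists_congr fun L => ?_
  rw [VL_iff hz]
  refine and_congr_right fun hv => ?_
  refine RL_iff (fun i h => ?_) μ d
  have := hv.inj h
  rcases hz i with h' | h' <;> simp only [Equiv.coe_addRight] at h' <;> rw [← this] at h' <;> linarith [h'.1]

lemma FF.shift {n : ℕ} {x : ZMod n → ℝ} {μ : ZMod n → Prop} {ε : Prop} (c : ZMod n)
    (h : FF (Equiv.addRight (1 : ZMod n)) x μ ε) :
    FF (Equiv.addRight (1 : ZMod n)) (fun i => x (c + i)) (fun i => μ (c + i)) ε := by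
  obtain ⟨L, hv, s, h1, h2, t, ht, hst⟩ := h
  simp only [Equiv.coe_addRight] at h1 h2
  have i1 := hv.h1
  have i2 := hv.h2
  simp only [Equiv.coe_addRight] at i1 i2
  refine ⟨fun i => L (c + i), ⟨fun a b h => by simpa using hv.inj h, ?_, ?_⟩, fun i => s (c + i), ?_, ?_, t - c, ?_, ?_⟩
  · intro i e h
    simp only [Equiv.coe_addRight, ← add_assoc] at h ⊢
    exact i1 _ _ h
  · intro i j hij h h'
    simp only [Equiv.coe_addRight, ← add_assoc] at h h' ⊢
    exact i2 _ _ (by simpa using hij) h h'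
  · intro i; simp only [Equiv.coe_addRight, ← add_assoc]; exact h1 _
  · intro i; simp only [Equiv.coe_addRight, ← add_assoc]; exact h2 _
  · intro j; simpa using ht _
  · simpa using hst

lemma FF.trans_x {n : ℕ} {x : ZMod n → ℝ} {μ : ZMod n → Prop} {ε : Prop} (c : ℝ)
    (h : FF (Equiv.addRight (1 : ZMod n)) x μ ε) :
    FF (Equiv.addRight (1 : ZMod n)) (fun i => c + x i) μ ε := by
  obtain ⟨L, hv, h⟩ := h
  refine ⟨L, ⟨hv.inj, ?_, ?_⟩, h⟩
  · intro i e h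
    simp only [add_lt_add_iff_left] at h
    exact hv.h1 i e h
  · intro i j hij h h'
    simp only [add_lt_add_iff_left, add_right_inj] at h h'
    exact hv.h2 i j hij h h'

noncomputable def XX {n : ℕ} (θ : ZMod n → ℝ) (c : ZMod n) (j : ℕ) : ℝ :=
  ∑ l ∈ Finset.range j, (-1 : ℝ) ^ l * θ (c + l)

lemma XX_succ {n : ℕ} (θ : ZMod n → ℝ) (c : ZMod n) (j : ℕ) :
    XX θ c (j + 1) = XX θ c j + (-1) ^ j * θ (c + j) := Finset.sum_range_succ _ _

lemma XX_fold {n : ℕ} {θ : ZMod n → ℝ} (hcc : IsClosedCycle n θ) (c : ZMod n) (j : ℕ) :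
    foldedX n θ (c + j) = foldedX n θ c + (-1) ^ c.val * XX θ c j ∧
      (-1 : ℝ) ^ (c + j).val = (-1) ^ c.val * (-1) ^ j := by
  induction j with
  | zero => simp [XX]
  | succ j ih =>
    have e : c + ((j + 1 : ℕ) : ZMod n) = c + j + 1 := by push_cast; ring
    rw [e, folded_step hcc, parity_succ hcc.2.1 hcc.1, ih.1, ih.2, XX_succ, pow_succ]
    constructor <;> ring

lemma XX_n {n : ℕ} {θ : ZMod n → ℝ} (hcc : IsClosedCycle n θ) (c : ZMod n) : XX θ c n = 0 := by
  have := (XX_fold hcc c n).1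
  rw [ZMod.natCast_self, add_zero] at this
  have h : (-1 : ℝ) ^ c.val * XX θ c n = 0 := by linarith
  rcases mul_eq_zero.1 h with h | h
  · exact absurd h (pow_ne_zero _ (by norm_num))
  · exact h

lemma flat_FN {n : ℕ} {θ : ZMod n → ℝ} (hcc : IsClosedCycle n θ) (c : ZMod n) (μ : ZMod n → MV) (d : Des) :
    FlatFoldable n θ μ d ↔ FN n (XX θ c) (fun j => μ (c + (j : ZMod n)) = MV.valley) (d = Des.exterior) := by
  haveI : NeZero n := ⟨by have := hcc.2.1; omega⟩
  rw [flat_iff hcc]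
  have hz := folded_zig hcc
  unfold FN
  have e1 : (fun i : ZMod n => foldedX n θ (c + i)) = fun i => foldedX n θ c + (-1) ^ c.val * XX θ c i.val := by
    funext i
    rw [← (XX_fold hcc c i.val).1, ZMod.natCast_zmod_val]
  have e2 : (fun i : ZMod n => μ (c + ((i.val : ℕ) : ZMod n)) = MV.valley) = fun i => μ (c + i) = MV.valley := by
    funext i; rw [ZMod.natCast_zmod_val]
  have zz : Zig (Equiv.addRight (1 : ZMod n)) (fun i : ZMod n => XX θ c i.val) ∧
      Zig (Equiv.addRight (1 : ZMod n)) (fun i : ZMod n => - XX θ c i.val) := by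
    have : Zig (Equiv.addRight (1 : ZMod n)) (fun i : ZMod n => foldedX n θ (c + i)) := fun i => by
      have := hz (c + i)
      simp only [Equiv.coe_addRight, ← add_assoc] at this ⊢
      exact this
    have h2 : Zig (Equiv.addRight (1 : ZMod n)) (fun i : ZMod n => (-1) ^ c.val * XX θ c i.val) := fun i => by
      have := this i
      rw [e1] at this
      simp only [add_lt_add_iff_left] at this
      exact this
    rcases neg_one_pow_eq_or ℝ c.val with h | h
    · simp only [h, one_mul] at h2; exact ⟨h2, h2.negx⟩
    · simp only [h, neg_one_mul] at h2; exact ⟨by simpa using h2.negx, h2⟩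
  have b : FF (Equiv.addRight (1 : ZMod n)) (fun i : ZMod n => (-1) ^ c.val * XX θ c i.val) (fun i => μ (c + i) = MV.valley) (d = Des.exterior) ↔
      FF (Equiv.addRight (1 : ZMod n)) (fun i : ZMod n => XX θ c i.val) (fun i => μ (c + i) = MV.valley) (d = Des.exterior) := by
    rcases neg_one_pow_eq_or ℝ c.val with h | h
    · simp only [h, one_mul]
    · simp only [h, neg_one_mul]
      exact ⟨fun h => by simpa using h.negx zz.2, fun h => h.negx zz.1⟩
  rw [e2, ← b]
  constructor
  · intro h
    have := h.shift c
    rw [e1] at this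
    simpa using this.trans_x (- foldedX n θ c)
  · intro h
    have := h.trans_x (foldedX n θ c)
    rw [← e1] at this
    simpa using this.shift (-c)

end Crimp

namespace Crimp
open Classical

lemma k_bound {n : ℕ} {θ : ZMod n → ℝ} (hcc : IsClosedCycle n θ) (m : ZMod n) (k : ℕ) (hkodd : Odd k)
    (hrun₂ : ∀ j : ℕ, j < k → θ (m + (j : ZMod n)) = θ m)
    (hrun₃ : θ m < θ (m + (k : ZMod n))) : k + 3 ≤ n := by
  have he := hcc.1
  have hn := hcc.2.1
  have h1 : k < n := by
    by_contra h
    have h2 : k % n < k := lt_of_lt_of_le (Nat.mod_lt _ (by omega)) (by omega)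
    have := hrun₂ _ h2
    rw [ZMod.natCast_mod] at this
    linarith
  have h2 : k + 1 ≠ n := by
    intro h
    have h0 := XX_n hcc m
    have hr : XX θ m n = XX θ m (k + 1) := by rw [h]
    rw [hr, XX_succ, hkodd.neg_one_pow] at h0
    have : ∀ j ≤ k, XX θ m j = if Even j then 0 else θ m := by
      intro j
      induction j with
      | zero => intro _; simp [XX]
      | succ j ih =>
        intro hj
        rw [XX_succ, ih (by omega), hrun₂ j (by omega)]
        rcases Nat.even_or_odd j with e | e
        · have : ¬ Even (j + 1) := by grind
          rw [if_pos e, if_neg this, e.neg_one_pow]; ring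
        · have h' : Even (j + 1) := by grind
          have h'' : ¬ Even j := by grind
          rw [if_neg h'', if_pos h', e.neg_one_pow]; ring
    rw [this k le_rfl, if_neg (by grind)] at h0
    linarith
  have h3 : k + 2 ≠ n := by
    rintro rfl
    grind
  omega

lemma main_aux (p k r : ℕ) (hr : k = 2 * r + 1) (hp : Odd p) (θ : ZMod (p + k + 2) → ℝ) (hcc : IsClosedCycle (p + k + 2) θ)
    (m : ZMod (p + k + 2))
    (hrun₁ : θ m < θ (m - 1))
    (hrun₂ : ∀ j : ℕ, j < k → θ (m + (j : ZMod (p + k + 2))) = θ m)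
    (hrun₃ : θ m < θ (m + (k : ZMod (p + k + 2)))) :
    IsClosedCycle (p + k + 2 - k - 1) (oddShrink (p + k + 2) θ m k) ∧
    ∀ (μ : ZMod (p + k + 2) → MV) (d : Des),
      FlatFoldable (p + k + 2) θ μ d ↔
        ((Finset.range (k + 1)).filter
            fun j : ℕ => μ (m + (j : ZMod (p + k + 2))) = MV.valley).card = (k + 1) / 2 ∧
        FlatFoldable (p + k + 2 - k - 1) (oddShrink (p + k + 2) θ m k) (oddRestrict (p + k + 2) μ m k) d := by
  have hk : Odd k := ⟨r, hr⟩
  have hpos := hcc.2.2.1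
  have hnz : ((p + k + 2 : ℕ) : ZMod (p + k + 2)) = 0 := ZMod.natCast_self _
  push_cast at hnz
  obtain ⟨c, hc⟩ : ∃ c, c = m + (k : ZMod (p + k + 2)) + 1 := ⟨_, rfl⟩
  have cp : c + (p : ZMod (p + k + 2)) = m - 1 := by rw [hc]; linear_combination hnz
  have cj : ∀ j : ℕ, c + ((p + 1 + j : ℕ) : ZMod (p + k + 2)) = m + j := by
    intro j; rw [hc]; push_cast; linear_combination hnz
  have X0 : XX θ c 0 = 0 := by simp [XX]
  have Xn := XX_n hcc c
  have Xp : XX θ c (p + 1) = XX θ c p - θ (m - 1) := by rw [XX_succ, hp.neg_one_pow, cp]; ring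
  have Xs : ∀ j, XX θ c (p + 1 + (j + 1)) = XX θ c (p + 1 + j) + (-1) ^ j * θ (m + j) := by
    intro j
    rw [← add_assoc, XX_succ, cj, pow_add, (show Even (p + 1) by grind).neg_one_pow, one_mul]
  have Xj : ∀ j ≤ k, XX θ c (p + 1 + j) = if Even j then XX θ c (p + 1) else XX θ c (p + 1) + θ m := by
    intro j
    induction j with
    | zero => intro _; simp
    | succ j ih =>
      intro hj
      rw [Xs, ih (by omega), hrun₂ j (by omega)]
      rcases Nat.even_or_odd j with e | e
      · have : ¬ Even (j + 1) := by grind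
        rw [if_pos e, if_neg this, e.neg_one_pow]; ring
      · have h' : Even (j + 1) := by grind
        have h'' : ¬ Even j := by grind
        rw [if_neg h'', if_pos h', e.neg_one_pow]; ring
  have Xa : XX θ c (p + 1) = θ (m + (k : ZMod (p + k + 2))) - θ m := by
    have e : XX θ c (p + k + 2) = XX θ c (p + 1 + (k + 1)) := by congr 1; omega
    rw [e, Xs, Xj k le_rfl, if_neg (by grind), hk.neg_one_pow] at Xn
    linarith
  have run : Run p k (XX θ c (p + 1)) (XX θ c (p + 1) + θ m) (XX θ c) := by
    refine ⟨?_, ?_, ?_, ?_, ?_, ?_⟩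
    · intro i hi
      have := hpos (c + i)
      rw [XX_succ]
      constructor <;> intro h <;> rw [h.neg_one_pow] <;> linarith
    · linarith [hpos m]
    · linarith
    · rw [X0, Xa]; linarith
    · intro j hj h; rw [Xj j hj, if_pos h]
    · intro j hj h; rw [Xj j hj, if_neg (by grind)]
  have hN : p + k + 2 - k - 1 = p + 1 := by omega
  have hN2 : p + k + 2 - k - 2 = p := by omega
  haveI : NeZero (p + k + 2 - k - 1) := ⟨by omega⟩
  have os : ∀ l < p, oddShrink (p + k + 2) θ m k (l : ZMod (p + k + 2 - k - 1)) = θ (c + l) := by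
    intro l hl
    unfold oddShrink
    rw [ZMod.val_cast_of_lt (by omega), if_neg (by omega), hc]
  have ol : oddShrink (p + k + 2) θ m k (p : ZMod (p + k + 2 - k - 1)) = θ (m - 1) - θ m + θ (m + (k : ZMod (p + k + 2))) := by
    unfold oddShrink
    rw [ZMod.val_cast_of_lt (by omega), if_pos (by omega)]
  have sm : ∀ j ≤ p, ∑ l ∈ Finset.range j, (-1 : ℝ) ^ l * oddShrink (p + k + 2) θ m k (l : ZMod (p + k + 2 - k - 1)) = XX θ c j := by
    intro j hj
    unfold XX
    refine Finset.sum_congr rfl fun l hl => ?_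
    rw [os l (by have := Finset.mem_range.1 hl; omega)]
  have hcc' : IsClosedCycle (p + k + 2 - k - 1) (oddShrink (p + k + 2) θ m k) := by
    refine ⟨by rw [hN]; grind, by have := hp.pos; omega, ?_, ?_⟩
    · intro i
      unfold oddShrink
      split_ifs
      · linarith [hpos (m - 1), hpos (m + k)]
      · exact hpos _
    · have e : Finset.range (p + k + 2 - k - 1) = Finset.range (p + 1) := by rw [hN]
      rw [e, Finset.sum_range_succ, sm p le_rfl, ol, hp.neg_one_pow]
      linarith
  refine ⟨hcc', fun μ d => ?_⟩
  have key : FlatFoldable (p + k + 2 - k - 1) (oddShrink (p + k + 2) θ m k) (oddRestrict (p + k + 2) μ m k) d ↔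
      FN (p + 1) (XX θ c) (fun j => μ (c + (j : ZMod (p + k + 2))) = MV.valley) (d = Des.exterior) := by
    rw [flat_iff hcc', ← hN]
    unfold FN
    have e : (fun i : ZMod (p + k + 2 - k - 1) => XX θ c i.val) = foldedX (p + k + 2 - k - 1) (oddShrink (p + k + 2) θ m k) := by
      funext i
      have := ZMod.val_lt i
      unfold foldedX
      rw [sm _ (by omega)]
    rw [e]
    unfold oddRestrict
    rw [hc]
  have e : FN (p + k + 2) (XX θ c) (fun j => μ (c + (j : ZMod (p + k + 2))) = MV.valley) (d = Des.exterior) ↔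
      FN (p + (2 * r + 1) + 2) (XX θ c) (fun j => μ (c + (j : ZMod (p + k + 2))) = MV.valley) (d = Des.exterior) := by
    rw [← hr]
  have run' : Run p (2 * r + 1) (XX θ c (p + 1)) (XX θ c (p + 1) + θ m) (XX θ c) := by
    rw [← hr]; exact run
  rw [key, flat_FN hcc c, e, run_main p hp _ _ _ r _ _ run']
  have e2 : (k + 1) / 2 = r + 1 := by omega
  have e3 : k + 1 = 2 * r + 2 := by omega
  rw [e2, Finset.card_filter, e3]
  simp only [cj]

end Crimp

/-- Case C: for a run of `k` (odd) equal minimal lengths surrounded by strictly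
longer edges, `f'` is again a closed cycle, and an MV assignment is flat
foldable iff exactly half of the `k + 1` creases of the run are valleys and the
restricted assignment is flat foldable on `f'` (with the same designation). -/
theorem odd_run_reduction (n : ℕ) (θ : ZMod n → ℝ) (hcc : IsClosedCycle n θ)
    (hne : ∃ i j : ZMod n, θ i ≠ θ j)
    (m : ZMod n) (k : ℕ) (hk1 : 1 ≤ k) (hkodd : Odd k)
    (hrun₁ : θ m < θ (m - 1))
    (hrun₂ : ∀ j : ℕ, j < k → θ (m + (j : ZMod n)) = θ m)
    (hrun₃ : θ m < θ (m + (k : ZMod n))) :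
    IsClosedCycle (n - k - 1) (oddShrink n θ m k) ∧
    ∀ (μ : ZMod n → MV) (d : Des),
      FlatFoldable n θ μ d ↔
        ((Finset.range (k + 1)).filter
            fun j : ℕ => μ (m + (j : ZMod n)) = MV.valley).card = (k + 1) / 2 ∧
        FlatFoldable (n - k - 1) (oddShrink n θ m k) (oddRestrict n μ m k) d := by
  have hb := Crimp.k_bound hcc m k hkodd hrun₂ hrun₃
  obtain ⟨p, rfl⟩ : ∃ p, n = p + k + 2 := ⟨n - k - 2, by omega⟩
  obtain ⟨r, hr⟩ := id hkodd
  have hp : Odd p := by have := hcc.1; grind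
  have := Crimp.main_aux p k r hr hp θ hcc m hrun₁ hrun₂ hrun₃
  refine ⟨this.1, fun μ d => ?_⟩
  rw [this.2 μ d]
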